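/- arXiv:2111.13200 — 3 statements merged into one kernel-verified Lean document; each statement's English description precedes it below -/
import Mathlib

section
/- Let κ be a kernel on S, let k ∈ ℕ₀^S with k ≠ 0, let r ∈ S, and set S_k = {s ∈ S : k_s > 0}. Define Δ_r(k) = ∑_A ∏_{(s,s')∈E(A)} κ(s,s') · k_s, where the sum runs over all spanning trees A of the complete graph on the vertex set S_k, rooted at r, with every edge directed away from the root, and (s,s') runs over the directed edges of A (s the parent, s' the child); set Δ_r(k) = 0 if r ∉ S_k. Then τ(k;κ) · k_r = (∏_{s∈S_k} ((κk)_s)^{k_s − 1}) · Δ_r(k), with the convention 0^0 = 1. -/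
open scoped Classical ENNReal
open Filter MeasureTheory

noncomputable section

/-- The set of ordered pairs `(i,j)` of vertices with `i < j`, representing the
potential edges of a graph on `Fin n`. -/
def upperPairs (n : ℕ) : Finset (Fin n × Fin n) :=
  Finset.univ.filter fun q => q.1 < q.2

/-- The simple graph on `Fin n` determined by a finite set of (ordered) edges. -/
def graphOf {n : ℕ} (E : Finset (Fin n × Fin n)) : SimpleGraph (Fin n) :=
  SimpleGraph.fromRel fun i j => (i, j) ∈ E

/-- `PConn n x p` is the probability that the inhomogeneous random graph `G(n, x, p)`,
with type vector `x` and independent edges where `{i,j}` is present with probability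
`p (x i) (x j)`, is connected; written as a finite sum over connected graphs. -/
def PConn {S : Type*} (n : ℕ) (x : Fin n → S) (p : S → S → ℝ) : ℝ :=
  ∑ E ∈ (upperPairs n).powerset.filter (fun E => (graphOf E).Connected),
    (∏ q ∈ E, p (x q.1) (x q.2)) * ∏ q ∈ upperPairs n \ E, (1 - p (x q.1) (x q.2))

/-- Sum over all spanning trees (connected graphs with `n - 1` edges) on `Fin n` of the
product of the kernel over the edges. -/
def treeWeight {S : Type*} (n : ℕ) (x : Fin n → S) (κ : S → S → ℝ) : ℝ :=
  ∑ E ∈ (upperPairs n).powerset.filter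
      (fun E => (graphOf E).Connected ∧ E.card + 1 = n),
    ∏ q ∈ E, κ (x q.1) (x q.2)

/-- A canonical list of types compatible with the multiplicity vector `k`. -/
def compatList {S : Type*} [Fintype S] (k : S → ℕ) : List S :=
  (∑ s : S, (k s) • ({s} : Multiset S)).toList

lemma compatList_length {S : Type*} [Fintype S] (k : S → ℕ) :
    (compatList k).length = ∑ s : S, k s := by
  simp [compatList]

/-- A canonical type vector compatible with `k`, i.e. with `∑ i δ_{x i} = k`. -/
def compatVec {S : Type*} [Fintype S] (k : S → ℕ) : Fin (∑ s : S, k s) → S :=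
  fun i => (compatList k).get (Fin.cast (compatList_length k).symm i)

/-- `tau κ k` is the spanning-tree weight `τ(k; κ)`. -/
def tau {S : Type*} [Fintype S] (κ : S → S → ℝ) (k : S → ℕ) : ℝ :=
  treeWeight (∑ s : S, k s) (compatVec k) κ

/-- `pN κN N k` is the probability that the inhomogeneous random graph on a vertex set
with type composition `k` and edge probabilities `min 1 (κN/N)` is connected. -/
def pN {S : Type*} [Fintype S] (κN : S → S → ℝ) (N : ℕ) (k : S → ℕ) : ℝ :=
  PConn (∑ s : S, k s) (compatVec k) fun r s => min 1 (κN r s / N)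

/-- Extended-real logarithm, with `elog x = -∞` for `x ≤ 0`. -/
def elog (x : ℝ) : EReal := if x ≤ 0 then (⊥ : EReal) else ((Real.log x : ℝ) : EReal)

/-- The nonnegative part of `-log u`, equal to `∞` if `u ≤ 0`. -/
def negLogPart (u : ℝ) : ℝ≥0∞ := if u ≤ 0 then ⊤ else ENNReal.ofReal (-Real.log u)

/-- The relative-entropy summand `x log (x / d)` with conventions `0 log 0 = 0` and
`x log (x/0) = +∞` for `x ≠ 0`. -/
def entTerm (x d : ℝ) : EReal :=
  if x = 0 then (0 : EReal) else if d ≤ 0 then (⊤ : EReal)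
  else ((x * Real.log (x / d) : ℝ) : EReal)

/-- `‖κ‖_∞ = max_{r,s} κ r s`. -/
def kernelSup {S : Type*} [Fintype S] [Nonempty S] (κ : S → S → ℝ) : ℝ :=
  Finset.univ.sup' Finset.univ_nonempty fun r =>
    Finset.univ.sup' Finset.univ_nonempty fun s => κ r s

/-- `Σ(κ, ν)`, the `ℓ²(ν)`-operator norm of the matrix `(κ r s * ν s)_{r,s}`. -/
def sigmaOp {S : Type*} [Fintype S] (κ : S → S → ℝ) (ν : S → ℝ) : ℝ :=
  sSup { t : ℝ | ∃ f : S → ℝ, (∀ s, 0 ≤ f s) ∧ (∑ r : S, ν r * f r ^ 2) ≤ 1 ∧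
    t = Real.sqrt (∑ r : S, ν r * (∑ s : S, κ r s * f s * ν s) ^ 2) }

/-- Irreducibility of the kernel `κ` with respect to `ν`. -/
def Irred {S : Type*} (κ : S → S → ℝ) (ν : S → ℝ) : Prop :=
  ∀ A : Set S, (∀ r ∈ A, ∀ s, s ∉ A → 0 < ν r → 0 < ν s → κ r s = 0) →
    (∀ r ∈ A, ν r = 0) ∨ (∀ s, s ∉ A → ν s = 0)

/-- The generating series `Γ_r(θ) = ∑_k τ(k) k_r ∏_s θ_s^{k_s}/k_s! ∈ [0,∞]`. -/
def Gamma0 {S : Type*} [Fintype S] (κ : S → S → ℝ) (θ : S → ℝ) (r : S) : ℝ≥0∞ :=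
  ∑' k : S → ℕ,
    ENNReal.ofReal (tau κ k * (k r : ℝ) * ∏ s : S, θ s ^ (k s) / (Nat.factorial (k s) : ℝ))

/-- `χ(κ, θ)`: the infimum over probability vectors `w ≪ θ` of
`∑_r w_r log (w_r / ((κ w)_r θ_r))`. -/
def chiFn {S : Type*} [Fintype S] (κ : S → S → ℝ) (θ : S → ℝ) : EReal :=
  sInf { v : EReal | ∃ w : S → ℝ, (∀ r, 0 ≤ w r) ∧ ((∑ r : S, w r) = 1) ∧
    (∀ r, θ r = 0 → w r = 0) ∧
    v = ∑ r : S, entTerm (w r) ((∑ s : S, κ r s * w s) * θ r) }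

/-- `Δ_r(k)`: the sum over directed spanning trees of the support of `k` rooted at `r`
(encoded as parent maps `f`, edges `(f s, s)` directed away from the root) of
`∏ κ(f s, s) * k (f s)`. -/
def Delta {S : Type*} [Fintype S] [DecidableEq S] (κ : S → S → ℝ) (k : S → ℕ) (r : S) : ℝ :=
  ∑ f ∈ (Finset.univ : Finset (S → S)).filter (fun f =>
      (∀ s, (s = r ∨ k s = 0) → f s = s) ∧
      ∀ s, 0 < k s → s ≠ r → (0 < k (f s) ∧ ∃ n, f^[n] s = r)),
    ∏ s ∈ Finset.univ.filter (fun s => 0 < k s ∧ s ≠ r), (κ (f s) s * (k (f s) : ℝ))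

/-- The reference weight `τ(k) ∏_s μ_s^{k_s}/k_s!`. -/
def rhoMu {S : Type*} [Fintype S] (κ : S → S → ℝ) (μ : S → ℝ) (k : S → ℕ) : ℝ :=
  tau κ k * ∏ s : S, μ s ^ (k s) / (Nat.factorial (k s) : ℝ)

/-- The microscopic rate function `I_Mi`. -/
def IMi {S : Type*} [Fintype S] (κ : S → S → ℝ) (μ : S → ℝ) (lam : (S → ℕ) → ℝ) : EReal :=
  (∑' k : S → ℕ, entTerm (lam k) (rhoMu κ μ k))
  + ((∑' k : S → ℕ, lam k * (((∑ s : S, k s : ℕ) : ℝ) - 1) : ℝ) : EReal)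
  + ((((1 : ℝ)/2) * ∑ r : S, ∑ s : S, (∑' k : S → ℕ, lam k * (k r : ℝ)) * κ r s * μ s : ℝ) : EReal)

/-- The minimizer candidate `λ_k(c) = τ(k) ∏_s (c_s e^{-(κ c)_s})^{k_s}/k_s!`. -/
def lamC {S : Type*} [Fintype S] (κ : S → S → ℝ) (c : S → ℝ) (k : S → ℕ) : ℝ :=
  tau κ k * ∏ s : S, (c s * Real.exp (-(∑ t : S, κ s t * c t))) ^ (k s) / (Nat.factorial (k s) : ℝ)

/-- The mesoscopic rate function `I_Me`. -/
def IMe {S : Type*} [Fintype S] (κ : S → S → ℝ) (μ ν : S → ℝ) : EReal :=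
  (∑ r : S, entTerm (ν r) ((∑ s : S, κ r s * ν s) * μ r))
  + ((((1 : ℝ)/2) * ∑ r : S, ∑ s : S, ν r * κ r s * μ s : ℝ) : EReal)

/-- `b` is a solution of the fixed-point system for `c`:
`b ∈ [0,∞)^S`, `b ≤ c` and `(κ(c-b))_r b_r = c_r - b_r` for all `r`. -/
def IsFPSol {S : Type*} [Fintype S] (κ : S → S → ℝ) (c b : S → ℝ) : Prop :=
  (∀ r, 0 ≤ b r) ∧ (∀ r, b r ≤ c r) ∧
    ∀ r, (∑ s : S, κ r s * (c s - b s)) * b r = c r - b r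

/-- The macroscopic rate summand `f_Ma`. -/
def fMa {S : Type*} [Fintype S] (κ : S → S → ℝ) (μ y : S → ℝ) : EReal :=
  (∑ r : S, entTerm (y r) ((1 - Real.exp (-(∑ s : S, κ r s * y s))) * μ r))
  + ((((1 : ℝ)/2) * ∑ r : S, ∑ s : S, y r * κ r s * (μ s - y s) : ℝ) : EReal)

/-- The functional `G_c(b)`. -/
def Gc {S : Type*} [Fintype S] (κ : S → S → ℝ) (μ c b : S → ℝ) : EReal :=
  (((∑ r : S, b r * Real.log (b r / μ r))
      - (1/2) * ∑ r : S, ∑ s : S, b r * κ r s * b s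
      + (1/2) * ∑ r : S, ∑ s : S, c r * κ r s * μ s : ℝ) : EReal)
  + ∑ r : S, entTerm (c r - b r) ((∑ s : S, κ r s * (c s - b s)) * μ r)

/-- `λ_k(t) = t^{|k|-1} τ(k) e^{-t⟨k,κμ⟩} ∏_r μ_r^{k_r}/k_r!`. -/
def lamT {S : Type*} [Fintype S] (κ : S → S → ℝ) (μ : S → ℝ) (k : S → ℕ) (t : ℝ) : ℝ :=
  t ^ ((∑ s : S, k s) - 1) * tau κ k *
    Real.exp (-t * ∑ r : S, ∑ s : S, (k r : ℝ) * κ r s * μ s) *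
    ∏ r : S, μ r ^ (k r) / (Nat.factorial (k r) : ℝ)

open scoped Matrix in
lemma aux_det_one {V : Type*} [Fintype V] [DecidableEq V] (A : Finset V) (f : V → V)
    (h : ∀ i, ∃ n, f^[n] i ∉ A) :
    (Matrix.of fun i => (Pi.single i (1:ℝ) : V → ℝ) -
      (if i ∈ A then Pi.single (f i) (1:ℝ) else 0)).det = 1 := by
  set P : Matrix V V ℝ := Matrix.of fun i => (if i ∈ A then Pi.single (f i) (1:ℝ) else 0) with hP
  have hmv : ∀ v : V → ℝ, ∀ i, (P *ᵥ v) i = if i ∈ A then v (f i) else 0 := by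
    intro v i
    by_cases hi : i ∈ A
    · simp [hP, Matrix.mulVec, hi]
    · simp [hP, Matrix.mulVec, hi]
  have hpow : ∀ m, ∀ v : V → ℝ, ∀ i n, n < m → f^[n] i ∉ A → ((P ^ m) *ᵥ v) i = 0 := by
    intro m
    induction m with
    | zero => intro v i n hn; omega
    | succ m ih =>
      intro v i n hn hA
      rw [pow_succ', ← Matrix.mulVec_mulVec, hmv]
      split_ifs with hi
      · cases n with
        | zero => exact absurd hi hA
        | succ n => exact ih v (f i) n (by omega) (by simpa using hA)
      · rfl
  choose g hg using h
  have hnil : IsNilpotent P := by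
    refine ⟨Finset.univ.sup g + 1, ?_⟩
    ext i j
    have := hpow (Finset.univ.sup g + 1) (Pi.single j 1) i (g i)
      (Nat.lt_succ_of_le (Finset.le_sup (Finset.mem_univ i))) (hg i)
    simpa using this
  have h1 := (Matrix.isNilpotent_charpoly_sub_pow_of_isNilpotent hnil).eq_zero
  have h2 := congrArg (Polynomial.eval (1:ℝ)) (sub_eq_zero.mp h1)
  rw [Matrix.eval_charpoly] at h2
  simp only [Polynomial.eval_pow, Polynomial.eval_X, one_pow, map_one] at h2
  refine Eq.trans (congrArg Matrix.det ?_) h2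
  ext i j
  simp [hP, Matrix.one_apply, Pi.single_apply, eq_comm]

lemma aux_det_zero {V : Type*} [Fintype V] [DecidableEq V] (A : Finset V) (f : V → V)
    (h : ¬ ∀ i, ∃ n, f^[n] i ∉ A) :
    (Matrix.of fun i => (Pi.single i (1:ℝ) : V → ℝ) -
      (if i ∈ A then Pi.single (f i) (1:ℝ) else 0)).det = 0 := by
  push Not at h
  obtain ⟨i0, h0⟩ := h
  rw [← Matrix.exists_mulVec_eq_zero_iff]
  refine ⟨fun i => if ∀ n, f^[n] i ∈ A then 1 else 0, ?_, ?_⟩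
  · intro h
    have := congrFun h i0
    simp [h0] at this
  · ext i
    have key : (∀ n, f^[n] i ∈ A) ↔ i ∈ A ∧ ∀ n, f^[n] (f i) ∈ A := by
      constructor
      · intro h; exact ⟨h 0, fun n => h (n+1)⟩
      · rintro ⟨h, h'⟩ n
        cases n with
        | zero => exact h
        | succ n => exact h' n
    by_cases hi : i ∈ A
    · simp only [Matrix.mulVec, Matrix.of_apply, hi, if_true, sub_dotProduct, single_dotProduct, one_mul]
      rw [key]; simp [hi]
    · simp only [Matrix.mulVec, Matrix.of_apply, hi, if_false, sub_zero, single_dotProduct, one_mul]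
      rw [key]; simp [hi]

/-- all-minors style matrix-tree theorem -/
lemma aux_forest {V : Type*} [Fintype V] [DecidableEq V] (A : Finset V) (a : V → V → ℝ) :
    (Matrix.of fun i => if i ∈ A then ∑ j, a i j • ((Pi.single i (1:ℝ) : V → ℝ) - Pi.single j 1)
      else Pi.single i 1).det =
    ∑ f ∈ (Finset.univ : Finset (V → V)).filter
      (fun f => (∀ i, i ∉ A → f i = i) ∧ ∀ i, ∃ n, f^[n] i ∉ A), ∏ i ∈ A, a i (f i) := by
  have h1 : (Matrix.of fun i => if i ∈ A then ∑ j, a i j • ((Pi.single i (1:ℝ) : V → ℝ) - Pi.single j 1)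
      else Pi.single i 1).det = (Matrix.detRowAlternating (R := ℝ) (n := V)).toMultilinearMap
      (fun i => ∑ j ∈ (if i ∈ A then Finset.univ else {i}), (if i ∈ A then a i j else 1) •
        ((Pi.single i (1:ℝ) : V → ℝ) - if i ∈ A then Pi.single j 1 else 0)) := by
    refine congrArg (Matrix.detRowAlternating (R := ℝ) (n := V)) ?_
    funext i
    change (if i ∈ A then ∑ j, a i j • ((Pi.single i (1:ℝ) : V → ℝ) - Pi.single j 1)
      else Pi.single i 1) = _
    by_cases hi : i ∈ A <;> simp [hi]
  rw [h1, MultilinearMap.map_sum_finset]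
  have h2 : ∀ f : V → V, (Matrix.detRowAlternating (R := ℝ) (n := V)).toMultilinearMap
      (fun i => (if i ∈ A then a i (f i) else 1) •
        ((Pi.single i (1:ℝ) : V → ℝ) - if i ∈ A then Pi.single (f i) 1 else 0)) =
      if (∀ i, ∃ n, f^[n] i ∉ A) then ∏ i ∈ A, a i (f i) else 0 := by
    intro f
    rw [MultilinearMap.map_smul_univ]
    have : (∏ i, (if i ∈ A then a i (f i) else 1)) = ∏ i ∈ A, a i (f i) := by
      simp
    rw [this]
    split_ifs with h
    · have := aux_det_one A f h
      exact (congrArg (fun z => (∏ i ∈ A, a i (f i)) • z) this).trans (by simp)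
    · have := aux_det_zero A f h
      exact (congrArg (fun z => (∏ i ∈ A, a i (f i)) • z) this).trans (by simp)
  rw [Finset.sum_congr rfl (fun f _ => h2 f), ← Finset.sum_filter]
  refine Finset.sum_congr ?_ fun _ _ => rfl
  ext f
  simp only [Finset.mem_filter, Fintype.mem_piFinset, Finset.mem_univ, true_and]
  refine and_congr_left fun _ => forall_congr' fun i => ?_
  by_cases hi : i ∈ A <;> simp [hi]
lemma aux_tree {n : ℕ} (i0 : Fin n) (w : Fin n → Fin n → ℝ) (hw : ∀ i j, w i j = w j i) :
    ∑ E ∈ (upperPairs n).powerset.filter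
      (fun E => (graphOf E).Connected ∧ E.card + 1 = n), ∏ q ∈ E, w q.1 q.2 =
    ∑ f ∈ (Finset.univ : Finset (Fin n → Fin n)).filter
      (fun f => f i0 = i0 ∧ ∀ i, ∃ m, f^[m] i = i0), ∏ i ∈ Finset.univ.erase i0, w i (f i) := by
  symm
  let e : (Fin n → Fin n) → Fin n → Fin n × Fin n := fun f i => (min i (f i), max i (f i))
  have he : ∀ f g i j, e f i = e g j ↔ (i = j ∧ f i = g j) ∨ (i = g j ∧ f i = j) := by
    intro f g i j
    simp only [e, Prod.mk.injEq]
    constructor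
    · rintro ⟨h1, h2⟩
      rcases le_total i (f i) with h | h <;> rcases le_total j (g j) with h' | h' <;>
      simp only [h, h', min_eq_left, min_eq_right, max_eq_left, max_eq_right] at h1 h2 <;> tauto
    · rintro (⟨h1, h2⟩ | ⟨h1, h2⟩)
      · rw [h2, h1]; exact ⟨rfl, rfl⟩
      · rw [h2, h1, min_comm, max_comm]; exact ⟨rfl, rfl⟩
  -- two-periodic points cannot reach the root
  have hper : ∀ f : Fin n → Fin n, f i0 = i0 → (∀ i, ∃ m, f^[m] i = i0) →
      ∀ i, i ≠ i0 → f (f i) ≠ i := by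
    intro f h0 hr i hi hff
    obtain ⟨m, hm⟩ := hr i
    have h2 : ∀ m, f^[2*m] i = i := by
      intro m
      rw [Function.iterate_mul]
      exact Function.iterate_fixed (by simpa using hff) m
    have h3 : f^[2*m] i = i0 := by
      rw [two_mul, Function.iterate_add_apply, hm]
      exact Function.iterate_fixed h0 m
    exact hi ((h2 m).symm.trans h3)
  have hfix : ∀ f : Fin n → Fin n, f i0 = i0 → (∀ i, ∃ m, f^[m] i = i0) →
      ∀ i, i ≠ i0 → f i ≠ i := by
    intro f h0 hr i hi hff
    exact hper f h0 hr i hi (by rw [hff, hff])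
  have hinj : ∀ f : Fin n → Fin n, f i0 = i0 → (∀ i, ∃ m, f^[m] i = i0) →
      Set.InjOn (e f) (Finset.univ.erase i0 : Finset (Fin n)) := by
    intro f h0 hr i hi j hj hij
    rcases (he _ _ _ _).1 hij with h | h
    · exact h.1
    · exfalso
      refine hper f h0 hr i (by simpa using hi) ?_
      rw [h.2, ← h.1]
  refine Finset.sum_nbij (fun f => (Finset.univ.erase i0).image (e f)) ?_ ?_ ?_ ?_
  · intro f hf
    simp only [Finset.mem_filter, Finset.mem_univ, true_and] at hf
    obtain ⟨h0, hr⟩ := hf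
    simp only [Finset.mem_filter, Finset.mem_powerset]
    refine ⟨?_, ?_, ?_⟩
    · intro q hq
      simp only [Finset.mem_image, Finset.mem_erase, Finset.mem_univ, and_true] at hq
      obtain ⟨i, hi, rfl⟩ := hq
      simp only [upperPairs, Finset.mem_filter, Finset.mem_univ, true_and, e]
      exact min_lt_max.2 (hfix f h0 hr i hi).symm
    · have hadj : ∀ i, i ≠ i0 → (graphOf ((Finset.univ.erase i0).image (e f))).Adj i (f i) := by
        intro i hi
        simp only [graphOf, SimpleGraph.fromRel_adj]
        refine ⟨(hfix f h0 hr i hi).symm, ?_⟩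
        rcases le_total i (f i) with h | h
        · left
          exact Finset.mem_image.2 ⟨i, by simp [hi], by simp [e, h]⟩
        · right
          exact Finset.mem_image.2 ⟨i, by simp [hi], by simp [e, h]⟩
      have hreach : ∀ m i, f^[m] i = i0 →
          (graphOf ((Finset.univ.erase i0).image (e f))).Reachable i i0 := by
        intro m
        induction m with
        | zero => intro i hi; rw [show i = i0 from hi]
        | succ m ih =>
          intro i hi
          by_cases hii : i = i0
          · rw [hii]
          · exact (hadj i hii).reachable.trans (ih (f i) hi)
      have : Nonempty (Fin n) := ⟨i0⟩
      refine SimpleGraph.Connected.mk ?_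
      intro u v
      obtain ⟨m, hm⟩ := hr u
      obtain ⟨m', hm'⟩ := hr v
      exact (hreach m u hm).trans (hreach m' v hm').symm
    · rw [Finset.card_image_of_injOn (hinj f h0 hr), Finset.card_erase_of_mem (Finset.mem_univ _)]
      have := i0.2
      simp; omega
  · intro f hf g hg hfg
    simp only [Finset.coe_filter, Finset.mem_univ, true_and, Set.mem_ofPred_eq] at hf hg
    obtain ⟨h0, hr⟩ := hf
    obtain ⟨h0', hr'⟩ := hg
    have : ∀ m i, f^[m] i = i0 → f i = g i := by
      intro m
      induction m with
      | zero => intro i hi; rw [show i = i0 from hi, h0, h0']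
      | succ m ih =>
        intro i hi
        by_cases hii : i = i0
        · rw [hii, h0, h0']
        have h1 : e f i ∈ (Finset.univ.erase i0).image (e g) := by
          rw [← show _ = (Finset.univ.erase i0).image (e g) from hfg]
          exact Finset.mem_image_of_mem _ (by simp [hii])
        obtain ⟨j, hj, hij⟩ := Finset.mem_image.1 h1
        rcases (he _ _ _ _).1 hij with h | h
        · rw [← h.2, h.1]
        · exfalso
          have h2 := ih (f i) hi
          refine hper f h0 hr i hii ?_
          rw [h2, ← h.1, h.2]
    funext i
    obtain ⟨m, hm⟩ := hr i
    exact this m i hm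
  · intro E hE
    simp only [Finset.coe_filter, Finset.mem_powerset, Set.mem_ofPred_eq] at hE
    obtain ⟨hsub, hconn, hcard⟩ := hE
    have hnb : ∀ i, ∃ j, (i = i0 → j = i0) ∧ (i ≠ i0 → (graphOf E).Adj i j ∧
        (graphOf E).dist j i0 < (graphOf E).dist i i0) := by
      intro i
      by_cases hi : i = i0
      · exact ⟨i0, fun _ => rfl, fun h => absurd hi h⟩
      · obtain ⟨p, hp⟩ := hconn.exists_walk_length_eq_dist i i0
        cases p with
        | nil => exact absurd rfl hi
        | cons h p =>
          refine ⟨_, fun h => absurd h hi, fun _ => ⟨h, ?_⟩⟩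
          have := SimpleGraph.dist_le p
          simp at hp
          omega
    choose f hf0 hf using hnb
    have h0 : f i0 = i0 := hf0 i0 rfl
    have hr' : ∀ d i, (graphOf E).dist i i0 ≤ d → ∃ m, f^[m] i = i0 := by
      intro d
      induction d with
      | zero =>
        intro i hi
        refine ⟨0, ?_⟩
        by_contra h
        have := (hf i h).2
        omega
      | succ d ih =>
        intro i hi
        by_cases h : i = i0
        · exact ⟨0, h⟩
        · obtain ⟨m, hm⟩ := ih (f i) (by have := (hf i h).2; omega)
          exact ⟨m+1, hm⟩
    have hr : ∀ i, ∃ m, f^[m] i = i0 := fun i => hr' _ i le_rfl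
    refine ⟨f, by simpa using ⟨h0, hr⟩, ?_⟩
    refine Finset.eq_of_subset_of_card_le ?_ ?_
    · intro q hq
      simp only [Finset.mem_image, Finset.mem_erase, Finset.mem_univ, and_true] at hq
      obtain ⟨i, hi, rfl⟩ := hq
      have h1 := (hf i hi).1
      simp only [graphOf, SimpleGraph.fromRel_adj] at h1
      obtain ⟨hne, h1 | h1⟩ := h1
      · have h2 := hsub h1
        simp only [upperPairs, Finset.mem_filter, Finset.mem_univ, true_and] at h2
        simpa [e, h2.le] using h1
      · have h2 := hsub h1
        simp only [upperPairs, Finset.mem_filter, Finset.mem_univ, true_and] at h2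
        simpa [e, h2.le] using h1
    · rw [Finset.card_image_of_injOn (hinj f h0 hr), Finset.card_erase_of_mem (Finset.mem_univ _)]
      simp; omega
  · intro f hf
    simp only [Finset.mem_filter, Finset.mem_univ, true_and] at hf
    rw [Finset.prod_image (hinj f hf.1 hf.2)]
    refine Finset.prod_congr rfl fun i _ => ?_
    rcases le_total i (f i) with h | h
    · simp [e, h]
    · simp [e, h, hw i (f i)]

lemma aux_matrix {ι S : Type*} [Fintype ι] [DecidableEq ι] [Fintype S] [DecidableEq S]
    (x : ι → S) (i0 : ι) (k : S → ℕ) (hk : ∀ s, (Finset.univ.filter (fun i => x i = s)).card = k s)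
    (B : S → S → ℝ) (d : S → ℝ) (hd : ∀ s, d s ≠ 0) (hd1 : ∀ s, k s = 0 → d s = 1)
    (hB : ∀ s, k s = 0 → ∀ t, B s t = 0) (hBd : ∀ s, 0 < k s → ∑ t, B s t * (k t : ℝ) = d s) :
    (Matrix.of fun i => if i = i0 then (Pi.single i0 (1:ℝ) : ι → ℝ) else
        fun j => (if i = j then d (x i) else 0) - B (x i) (x j)).det * (k (x i0) : ℝ) =
      (∏ s, d s ^ (k s - 1)) *
      (Matrix.of fun s => if s = x i0 then (Pi.single (x i0) (1:ℝ) : S → ℝ) else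
        fun t => (if s = t then d s else 0) - B s t * (k t : ℝ)).det := by
  set r := x i0 with hr
  have hkr : 0 < k r := by
    rw [← hk r]; exact Finset.card_pos.2 ⟨i0, by simp [hr]⟩
  set M : Matrix ι ι ℝ := Matrix.of fun i => if i = i0 then (Pi.single i0 (1:ℝ) : ι → ℝ) else
        fun j => (if i = j then d (x i) else 0) - B (x i) (x j) with hM
  let D : Matrix ι ι ℝ := Matrix.diagonal fun i => d (x i)
  let X' : Matrix ι S ℝ := Matrix.of fun i s => if i = i0 then 0 else if x i = s then 1 else 0
  let Y : Matrix S ι ℝ := Matrix.of fun s j => (d s)⁻¹ * B s (x j)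
  let N0 : Matrix S S ℝ := Matrix.of fun s t => (if s = t then d s else 0) - B s t * (k t : ℝ)
  let DS : Matrix S S ℝ := Matrix.diagonal d
  let N1 : Matrix S S ℝ := Matrix.of fun s t => (if s = t then d s else 0) -
    B s t * ((k t : ℝ) - if t = r then 1 else 0)
  -- step 1
  have h1 : D * (1 - X' * Y) = M.updateRow i0 (d r • M i0) := by
    ext i j
    change (Matrix.diagonal (fun i => d (x i)) * (1 - X' * Y) : Matrix ι ι ℝ) i j = _
    rw [Matrix.diagonal_mul]
    simp only [Matrix.sub_apply, Matrix.mul_apply, X', Y, Matrix.of_apply]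
    by_cases hi : i = i0
    · subst hi
      simp [Matrix.one_apply, hM, Pi.single_apply, hr, eq_comm]
    · rw [Matrix.updateRow_ne hi]
      have := hd (x i)
      simp [hi, hM, Matrix.one_apply, mul_sub, this]
  have h2 : DS * (1 - Y * X') = N1 := by
    ext s t
    change (Matrix.diagonal d * (1 - Y * X') : Matrix S S ℝ) s t = _
    rw [Matrix.diagonal_mul]
    simp only [Matrix.sub_apply, Matrix.mul_apply, X', Y, Matrix.of_apply, N1]
    have h3 : ∑ j, (d s)⁻¹ * B s (x j) * (if j = i0 then (0:ℝ) else if x j = t then 1 else 0)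
        = (d s)⁻¹ * B s t * ((k t : ℝ) - if t = r then 1 else 0) := by
      have : ∀ j, (d s)⁻¹ * B s (x j) * (if j = i0 then (0:ℝ) else if x j = t then 1 else 0) =
          (d s)⁻¹ * B s t * ((if x j = t then 1 else 0) - (if j = i0 then (if t = r then 1 else 0) else 0)) := by
        intro j
        by_cases hj : j = i0
        · subst hj
          by_cases ht : t = r
          · simp [ht, hr]
          · have : ¬ x j = t := fun h => ht (by rw [← h])
            simp [ht, this]
        · by_cases hx : x j = t
          · simp [hj, hx]
          · simp [hj, hx]
      rw [Finset.sum_congr rfl fun j _ => this j, ← Finset.mul_sum, Finset.sum_sub_distrib]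
      congr 2
      · rw [← hk t]; simp
      · simp
    rw [h3, mul_sub, ← mul_assoc, ← mul_assoc, mul_inv_cancel₀ (hd s)]
    simp [Matrix.one_apply]
  have h3 : d r * M.det = (∏ s, d s ^ k s) * (1 - Y * X').det := by
    rw [← Matrix.det_one_sub_mul_comm X' Y]
    have : (D * (1 - X' * Y)).det = d r * M.det := by
      rw [h1, Matrix.det_updateRow_smul, Matrix.updateRow_eq_self]
    rw [← this, Matrix.det_mul, Matrix.det_diagonal]
    congr 1
    rw [Finset.prod_comp d x |>.trans ?_]
    rw [← Finset.prod_subset (Finset.subset_univ (Finset.univ.image x))]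
    · exact Finset.prod_congr rfl fun s _ => by rw [← hk s]
    · intro s _ hs
      have : k s = 0 := by
        rw [← hk s, Finset.card_eq_zero, Finset.filter_eq_empty_iff]
        intro i _ h
        exact hs (Finset.mem_image.2 ⟨i, Finset.mem_univ _, h⟩)
      simp [this]
  have h4 : (∏ s, d s ^ k s) = (∏ s, d s ^ (k s - 1)) * ∏ s, d s := by
    rw [← Finset.prod_mul_distrib]
    refine Finset.prod_congr rfl fun s _ => ?_
    rcases Nat.eq_zero_or_pos (k s) with h | h
    · simp [h, hd1 s h]
    · rw [← pow_succ, Nat.sub_add_cancel h]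
  have h5 : d r * M.det = (∏ s, d s ^ (k s - 1)) * N1.det := by
    rw [h3, h4, mul_assoc, ← h2, Matrix.det_mul, Matrix.det_diagonal]
  -- step 2
  have h6 : N0.det = 0 := by
    rw [← Matrix.exists_mulVec_eq_zero_iff]
    refine ⟨fun s => if 0 < k s then 1 else 0, ?_, ?_⟩
    · intro h
      have := congrFun h r
      simp [hkr] at this
    · ext s
      have e1 : ∀ t, ((if s = t then d s else 0) - B s t * (k t : ℝ)) * (if 0 < k t then (1:ℝ) else 0)
          = (if s = t then (if 0 < k s then d s else 0) else 0) - B s t * (k t : ℝ) := by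
        intro t
        rcases Nat.eq_zero_or_pos (k t) with h | h
        · by_cases hst : s = t
          · subst hst; simp [h]
          · simp [h, hst]
        · by_cases hst : s = t
          · subst hst; simp [h]
          · simp [h, hst]
      simp only [Matrix.mulVec, dotProduct, N0, Matrix.of_apply, Pi.zero_apply]
      rw [Finset.sum_congr rfl fun t _ => e1 t, Finset.sum_sub_distrib]
      rcases Nat.eq_zero_or_pos (k s) with h | h
      · simp [h, hB s h]
      · simp [h, hBd s h]
  have h7 : (k r : ℝ) * N1.det = d r * (N0.updateRow r (Pi.single r 1)).det := by
    have e1 : N1.updateCol r ((k r : ℝ) • fun s => N1 s r) =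
        N0.updateCol r ((((k r : ℝ) - 1) • fun s => N0 s r) + d r • Pi.single r 1) := by
      ext s t
      by_cases ht : t = r
      · rw [ht]
        by_cases hs : s = r
        · rw [hs]
          simp [N1, N0]; ring
        · simp [N1, N0, hs]; ring
      · simp [ht, N1, N0]
    have e2 : (N1.updateCol r fun s => N1 s r) = N1 := Matrix.updateCol_eq_self N1 r
    have e3 : (N0.updateCol r fun s => N0 s r) = N0 := Matrix.updateCol_eq_self N0 r
    have e4 := congrArg Matrix.det e1
    rw [Matrix.det_updateCol_smul, Matrix.det_updateCol_add, Matrix.det_updateCol_smul,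
      Matrix.det_updateCol_smul, e2, e3, h6, mul_zero, zero_add] at e4
    rw [e4, ← Matrix.cramer_apply, ← Matrix.adjugate_apply]
    congr 1
    rw [← Matrix.transpose_transpose N0, ← Matrix.adjugate_transpose, Matrix.transpose_apply, Matrix.adjugate_def]
    simp
  have h8 : (Matrix.of fun s => if s = r then (Pi.single r (1:ℝ) : S → ℝ) else
        fun t => (if s = t then d s else 0) - B s t * (k t : ℝ)) = N0.updateRow r (Pi.single r 1) := by
    ext s t
    by_cases hs : s = r
    · subst hs; simp
    · simp [hs, N0]
  rw [h8]
  apply mul_left_cancel₀ (hd r)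
  calc d r * (M.det * k r) = (d r * M.det) * k r := by ring
    _ = (∏ s, d s ^ (k s - 1)) * (k r * N1.det) := by rw [h5]; ring
    _ = _ := by rw [h7]; ring

lemma aux_card {S : Type*} [Fintype S] [DecidableEq S] (k : S → ℕ) (s : S) :
    (Finset.univ.filter (fun i => compatVec k i = s)).card = k s := by
  have h1 : List.ofFn (compatVec k) = compatList k := by
    apply List.ext_getElem
    · simp [compatList_length]
    · intro i h1 h2
      simp [compatVec]
  have h2 : (Finset.univ.val.map (compatVec k)).count s = k s := by
    rw [Fin.univ_val_map, h1, compatList, Multiset.coe_toList, Multiset.count_sum']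
    simp [Multiset.count_singleton]
  rw [Multiset.count_map] at h2
  rw [← h2, Finset.card_def, Finset.filter_val]
  congr 1
  refine Multiset.filter_congr fun i _ => ?_
  exact eq_comm

lemma aux_pos {S : Type*} [Fintype S] [DecidableEq S]
    (κ : S → S → ℝ) (hκsym : ∀ r s, κ r s = κ s r) (hκ0 : ∀ r s, 0 < κ r s)
    (k : S → ℕ) (r : S) (hr : 0 < k r) :
    tau κ k * (k r : ℝ) =
      (∏ s ∈ Finset.univ.filter (fun s => 0 < k s),
          (∑ t : S, κ s t * (k t : ℝ)) ^ (k s - 1)) * Delta κ k r := by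
  have hk := aux_card k
  set x := compatVec k with hx
  obtain ⟨i0, hi0⟩ : ∃ i0, x i0 = r := by
    have := hk r
    rw [← this, Finset.card_pos] at hr
    obtain ⟨i, hi⟩ := hr
    exact ⟨i, by simpa using hi⟩
  let d : S → ℝ := fun s => if 0 < k s then ∑ t, κ s t * (k t : ℝ) else 1
  let B : S → S → ℝ := fun s t => if 0 < k s then κ s t else 0
  have hkx : ∀ i, 0 < k (x i) := fun i => by
    rw [← hk (x i)]; exact Finset.card_pos.2 ⟨i, by simp⟩
  have hsum : ∀ g : S → ℝ, ∑ j, g (x j) = ∑ t, g t * (k t : ℝ) := by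
    intro g
    rw [← Finset.sum_fiberwise (s := Finset.univ) (g := x)]
    refine Finset.sum_congr rfl fun t _ => ?_
    rw [Finset.sum_congr rfl (g := fun _ => g t) (by
      intro i hi; rw [(Finset.mem_filter.1 hi).2])]
    rw [Finset.sum_const, hk t, nsmul_eq_mul, mul_comm]
  have hm := aux_matrix x i0 k hk B d ?_ ?_ ?_ ?_
  · rw [hi0] at hm
    have e1 : tau κ k = (Matrix.of fun i => if i = i0 then (Pi.single i0 (1:ℝ) : _ → ℝ) else
        fun j => (if i = j then d (x i) else 0) - B (x i) (x j)).det := by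
      have t1 := aux_tree i0 (fun i j => κ (x i) (x j)) (fun i j => hκsym _ _)
      have t2 := aux_forest (Finset.univ.erase i0) (fun i j => κ (x i) (x j))
      rw [tau, treeWeight, t1]
      have t3 : (Matrix.of fun i => if i = i0 then (Pi.single i0 (1:ℝ) : _ → ℝ) else
        fun j => (if i = j then d (x i) else 0) - B (x i) (x j)) = (Matrix.of fun i =>
          if i ∈ Finset.univ.erase i0 then ∑ j, κ (x i) (x j) •
            ((Pi.single i (1:ℝ) : _ → ℝ) - Pi.single j 1) else Pi.single i 1) := by
        ext i j
        by_cases hi : i = i0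
        · simp [hi]
        · simp only [Matrix.of_apply, hi, if_false, Finset.mem_erase, Finset.mem_univ, and_true,
            ne_eq, not_false_eq_true, if_true, Finset.sum_apply, Pi.smul_apply, Pi.sub_apply,
            smul_eq_mul, mul_sub, Finset.sum_sub_distrib, ← Finset.sum_mul]
          rw [hsum (fun t => κ (x i) t)]
          simp [d, B, hkx, Pi.single_apply, eq_comm]
      rw [t3, t2]
      refine Finset.sum_congr ?_ fun _ _ => rfl
      ext f
      simp
    have e2 : Delta κ k r = (Matrix.of fun s => if s = r then (Pi.single r (1:ℝ) : S → ℝ) else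
        fun t => (if s = t then d s else 0) - B s t * (k t : ℝ)).det := by
      have t2 := aux_forest (Finset.univ.filter (fun s => 0 < k s ∧ s ≠ r)) (fun s t => κ t s * (k t : ℝ))
      have t3 : (Matrix.of fun s => if s = r then (Pi.single r (1:ℝ) : S → ℝ) else
        fun t => (if s = t then d s else 0) - B s t * (k t : ℝ)) = (Matrix.of fun s =>
          if s ∈ Finset.univ.filter (fun s => 0 < k s ∧ s ≠ r) then ∑ t, (κ t s * (k t : ℝ)) •
            ((Pi.single s (1:ℝ) : _ → ℝ) - Pi.single t 1) else Pi.single s 1) := by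
        ext s t
        by_cases hs : s = r
        · simp [hs]
        · rcases Nat.eq_zero_or_pos (k s) with h | h
          · simp [hs, h, d, B, Pi.single_apply, eq_comm (a := t)]
          · simp only [Matrix.of_apply, hs, h, if_false, Finset.mem_filter, Finset.mem_univ, true_and,
              ne_eq, not_false_eq_true, if_true, Finset.sum_apply, Pi.smul_apply, Pi.sub_apply,
              smul_eq_mul, mul_sub, Finset.sum_sub_distrib, ← Finset.sum_mul]
            simp [d, B, h, Pi.single_apply, eq_comm, hκsym s]
      rw [t3, t2, Delta]
      refine Finset.sum_subset ?_ ?_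
      · intro f hf
        simp only [Finset.mem_filter, Finset.mem_univ, true_and] at hf ⊢
        obtain ⟨h1, h2⟩ := hf
        refine ⟨fun s hs => h1 s ?_, fun s => ?_⟩
        · by_contra hc
          push Not at hc
          exact hs ⟨Nat.pos_of_ne_zero hc.2, hc.1⟩
        · by_cases hs : 0 < k s ∧ s ≠ r
          · obtain ⟨n, hn⟩ := (h2 s hs.1 hs.2).2
            exact ⟨n, fun h => h.2 hn⟩
          · exact ⟨0, hs⟩
      · intro f hf hf'
        simp only [Finset.mem_filter, Finset.mem_univ, true_and] at hf hf'
        obtain ⟨h1, h2⟩ := hf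
        by_contra hne
        rw [← ne_eq, Finset.prod_ne_zero_iff] at hne
        have h3 : ∀ s, 0 < k s → 0 < k (f s) := by
          intro s hs
          by_cases hsr : s = r
          · rw [h1 s (fun h => h.2 hsr)]; exact hs
          · have := hne s (by simp [hs, hsr])
            apply Nat.pos_of_ne_zero
            intro h0
            simp [h0] at this
        apply hf'
        refine ⟨fun s hs => h1 s ?_, fun s hs hsr => ⟨h3 s hs, ?_⟩⟩
        · rintro ⟨h, h'⟩
          rcases hs with hs | hs
          · exact h' hs
          · omega
        · obtain ⟨n, hn⟩ := h2 s
          refine ⟨n, ?_⟩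
          have h4 : ∀ n, 0 < k (f^[n] s) := by
            intro n
            induction n with
            | zero => exact hs
            | succ n ih => rw [Function.iterate_succ_apply']; exact h3 _ ih
          by_contra hc
          exact hn ⟨h4 n, hc⟩
    rw [e1, e2, hm]
    congr 1
    rw [Finset.prod_filter]
    refine Finset.prod_congr rfl fun s _ => ?_
    rcases Nat.eq_zero_or_pos (k s) with h | h
    · simp [h]
    · simp [h, d]
  · intro s
    by_cases h : 0 < k s
    · simp only [d, h, if_true]
      refine ne_of_gt (Finset.sum_pos' (fun t _ => ?_) ⟨r, Finset.mem_univ _, ?_⟩)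
      · exact mul_nonneg (hκ0 _ _).le (Nat.cast_nonneg _)
      · exact mul_pos (hκ0 _ _) (Nat.cast_pos.2 hr)
    · simp [d, h]
  · intro s h; simp [d, h]
  · intro s h t; simp [B, h]
  · intro s h; simp [d, B, h]

lemma aux_Delta_zero {S : Type*} [Fintype S] [DecidableEq S]
    (κ : S → S → ℝ) (k : S → ℕ) (hk : k ≠ 0) (r : S) (hr : k r = 0) : Delta κ k r = 0 := by
  rw [Delta]
  refine Finset.sum_eq_zero fun f hf => ?_
  exfalso
  simp only [Finset.mem_filter, Finset.mem_univ, true_and] at hf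
  obtain ⟨s, hs⟩ := Function.ne_iff.1 hk
  have hs : 0 < k s := Nat.pos_of_ne_zero hs
  have hne : ∀ t, 0 < k t → t ≠ r := by
    rintro t ht rfl; omega
  obtain ⟨n, hn⟩ := (hf.2 s hs (hne s hs)).2
  have h4 : ∀ n, 0 < k (f^[n] s) := by
    intro n
    induction n with
    | zero => exact hs
    | succ n ih => rw [Function.iterate_succ_apply']; exact (hf.2 _ ih (hne _ ih)).1
  exact hne _ (h4 n) hn

/-- the directed-tree factorization of `τ(k) k_r`. -/
theorem tau_directed_tree_factorization
    {S : Type*} [Fintype S] [DecidableEq S] [Nonempty S]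
    (κ : S → S → ℝ) (hκsym : ∀ r s, κ r s = κ s r) (hκ0 : ∀ r s, 0 ≤ κ r s)
    (k : S → ℕ) (hk : k ≠ 0) (r : S) :
    tau κ k * (k r : ℝ) =
      (∏ s ∈ Finset.univ.filter (fun s => 0 < k s),
          (∑ t : S, κ s t * (k t : ℝ)) ^ (k s - 1)) * Delta κ k r := by
  rcases Nat.eq_zero_or_pos (k r) with hr | hr
  · rw [aux_Delta_zero κ k hk r hr, hr]; simp
  let F : ℝ → ℝ := fun ε => tau (fun s t => κ s t + ε) k * (k r : ℝ)
  let G : ℝ → ℝ := fun ε => (∏ s ∈ Finset.univ.filter (fun s => 0 < k s),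
          (∑ t : S, (κ s t + ε) * (k t : ℝ)) ^ (k s - 1)) * Delta (fun s t => κ s t + ε) k r
  have hF : Continuous F := by
    simp only [F, tau, treeWeight]
    fun_prop
  have hG : Continuous G := by
    simp only [G, Delta]
    fun_prop
  have hFG : ∀ ε ∈ Set.Ioi (0:ℝ), F ε = G ε := by
    intro ε hε
    exact aux_pos (fun s t => κ s t + ε) (fun s t => by simp only [hκsym s t])
      (fun s t => add_pos_of_nonneg_of_pos (hκ0 s t) hε) k r hr
  have h0 : F 0 = G 0 := by
    have hcl : (0:ℝ) ∈ closure (Set.Ioi (0:ℝ)) := by rw [closure_Ioi]; exact Set.self_mem_Ici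
    exact Set.EqOn.closure hFG hF hG hcl
  simpa [F, G] using h0


end
end

section
/- Let κ be a kernel on S and let θ ∈ [0,∞)^S be such that Γ_r(θ) < ∞ for every r ∈ S. Then for every r ∈ S, Γ_r(θ) = θ_r · exp( ∑_{s∈S} κ(r,s) Γ_s(θ) ). -/
open scoped Classical ENNReal
open Filter MeasureTheory

noncomputable section

/-! ### Graph weights -/

lemma reach_map {V W : Type*} {G : SimpleGraph V} {H : SimpleGraph W} (φ : V → W)
    (h : ∀ a b, G.Adj a b → H.Reachable (φ a) (φ b)) {a b : V} (hab : G.Reachable a b) :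
    H.Reachable (φ a) (φ b) := by
  obtain ⟨p⟩ := hab
  induction p with
  | nil => exact SimpleGraph.Reachable.refl _
  | cons hadj _ ih => exact (h _ _ hadj).trans ih

lemma reach_closed {V : Type*} {G : SimpleGraph V} (B : V → Prop)
    (h : ∀ a b, G.Adj a b → B a → B b) {a b : V} (hab : G.Reachable a b) (ha : B a) : B b := by
  obtain ⟨p⟩ := hab
  induction p with
  | nil => exact ha
  | cons hadj _ ih => exact ih (h _ _ hadj ha)

/-- weight of a graph -/
def gw {S : Type*} (κ : S → S → ℝ) {V : Type} [Fintype V] (x : V → S) (G : SimpleGraph V) : ℝ :=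
  ∏ i, ∏ j, if G.Adj i j then √(κ (x i) (x j)) else 1

/-- sum over graphs -/
def gsum {V : Type} [Fintype V] (P : SimpleGraph V → Prop) (f : SimpleGraph V → ℝ) : ℝ :=
  ∑ G : SimpleGraph V, if P G then f G else 0

/-- total tree weight -/
def TW {S : Type*} (κ : S → S → ℝ) {V : Type} [Fintype V] (x : V → S) : ℝ :=
  gsum (fun G => G.IsTree) (gw κ x)

lemma gw_comap {S : Type*} (κ : S → S → ℝ) {V W : Type} [Fintype V] [Fintype W] (e : V ≃ W)
    (x : W → S) (G : SimpleGraph W) : gw κ (x ∘ e) (G.comap e) = gw κ x G := by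
  unfold gw
  rw [← Equiv.prod_comp e]
  refine Finset.prod_congr rfl fun i _ => ?_
  rw [← Equiv.prod_comp e]
  rfl

lemma isTree_comap {V W : Type} (e : V ≃ W) (G : SimpleGraph W) :
    (G.comap e).IsTree ↔ G.IsTree :=
  (SimpleGraph.Iso.isTree_iff (SimpleGraph.Iso.comap e G))

lemma gsum_equiv {V W : Type} [Fintype V] [Fintype W] (e : V ≃ W)
    (P : SimpleGraph V → Prop) (f : SimpleGraph V → ℝ) :
    gsum P f = gsum (fun G => P (SimpleGraph.comap e G)) (fun G => f (SimpleGraph.comap e G)) := by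
  symm
  unfold gsum
  rw [← Equiv.sum_comp (e.symm.simpleGraph)]
  rfl

lemma gsum_filter {V : Type} [Fintype V] (P : SimpleGraph V → Prop) (f : SimpleGraph V → ℝ) :
    gsum P f = ∑ G ∈ (Finset.univ : Finset (SimpleGraph V)).filter P, f G := by
  rw [Finset.sum_filter]
  rfl

lemma gsum_congr {V : Type} [Fintype V] {P Q : SimpleGraph V → Prop} {f g : SimpleGraph V → ℝ}
    (hPQ : ∀ G, P G ↔ Q G) (hfg : ∀ G, P G → f G = g G) : gsum P f = gsum Q g := by
  unfold gsum
  refine Finset.sum_congr rfl fun G _ => ?_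
  by_cases h : P G
  · rw [if_pos h, if_pos ((hPQ G).1 h), hfg G h]
  · rw [if_neg h, if_neg (fun h' => h ((hPQ G).2 h'))]

lemma TW_equiv {S : Type*} (κ : S → S → ℝ) {V W : Type} [Fintype V] [Fintype W] (e : V ≃ W)
    (x : W → S) : TW κ (x ∘ e) = TW κ x := by
  unfold TW
  rw [gsum_equiv e]
  simp only [isTree_comap, gw_comap]

/-- join of two graphs along an edge -/
def joinG {A B : Type} (v : A) (u : B) (G : SimpleGraph A) (H : SimpleGraph B) :
    SimpleGraph (A ⊕ B) where
  Adj p q := match p, q with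
    | .inl a, .inl a' => G.Adj a a'
    | .inr b, .inr b' => H.Adj b b'
    | .inl a, .inr b => a = v ∧ b = u
    | .inr b, .inl a => a = v ∧ b = u
  symm := ⟨by
    rintro (a | a) (b | b) h
    · exact G.adj_symm h
    · exact h
    · exact h
    · exact H.adj_symm h⟩
  loopless := ⟨by
    rintro (a | a) h
    · exact G.irrefl h
    · exact H.irrefl h⟩

lemma gw_join {S : Type*} (κ : S → S → ℝ) (hs : ∀ r s, κ r s = κ s r) (h0 : ∀ r s, 0 ≤ κ r s)
    {A B : Type} [Fintype A] [Fintype B] (v : A) (u : B) (x : A → S) (y : B → S)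
    (G : SimpleGraph A) (H : SimpleGraph B) :
    gw κ (Sum.elim x y) (joinG v u G H) = κ (x v) (y u) * (gw κ x G * gw κ y H) := by
  unfold gw
  simp only [Fintype.prod_sum_type, Sum.elim_inl, Sum.elim_inr, Finset.prod_mul_distrib]
  have h1 : (∏ a : A, ∏ b : B, if (joinG v u G H).Adj (.inl a) (.inr b) then
      √(κ (x a) (y b)) else 1) = √(κ (x v) (y u)) := by
    rw [Finset.prod_eq_single v, Finset.prod_eq_single u]
    · simp [joinG]
    · intro b _ hb; simp [joinG, hb]
    · simp
    · intro a _ ha; simp [joinG, ha]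
    · simp
  have h2 : (∏ b : B, ∏ a : A, if (joinG v u G H).Adj (.inr b) (.inl a) then
      √(κ (y b) (x a)) else 1) = √(κ (x v) (y u)) := by
    rw [Finset.prod_comm, ← h1]
    refine Finset.prod_congr rfl fun a _ => Finset.prod_congr rfl fun b _ => ?_
    rw [hs, SimpleGraph.adj_comm]
  rw [h1, h2]
  change ((∏ i, ∏ j, if G.Adj i j then √(κ (x i) (x j)) else 1) * _) *
    (_ * (∏ i, ∏ j, if H.Adj i j then √(κ (y i) (y j)) else 1)) = _
  have := Real.mul_self_sqrt (h0 (x v) (y u))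
  generalize √(κ (x v) (y u)) = q at *
  rw [← this]
  ring

lemma joinG_isTree {A B : Type} (v : A) (u : B) {G : SimpleGraph A} {H : SimpleGraph B}
    (hG : G.IsTree) (hH : H.IsTree) : (joinG v u G H).IsTree := by
  have hGa := SimpleGraph.isAcyclic_iff_forall_adj_isBridge.1 hG.isAcyclic
  have hHa := SimpleGraph.isAcyclic_iff_forall_adj_isBridge.1 hH.isAcyclic
  refine ⟨?_, ?_⟩
  · have hA : ∀ a, (joinG v u G H).Reachable (.inl a) (.inl v) := fun a =>
      reach_map (G := G) Sum.inl (fun a b h => SimpleGraph.Adj.reachable (G := joinG v u G H) h)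
        (hG.connected.preconnected a v)
    have hB : ∀ b, (joinG v u G H).Reachable (.inr b) (.inl v) := fun b =>
      (reach_map (G := H) Sum.inr (fun a b h => SimpleGraph.Adj.reachable (G := joinG v u G H) h)
        (hH.connected.preconnected b u)).trans
        (SimpleGraph.Adj.reachable (G := joinG v u G H) ⟨rfl, rfl⟩)
    have hall : ∀ p, (joinG v u G H).Reachable p (.inl v) := by
      rintro (a | b)
      · exact hA a
      · exact hB b
    have : Nonempty (A ⊕ B) := ⟨.inl v⟩
    exact ⟨fun p q => (hall p).trans (hall q).symm⟩
  · rw [SimpleGraph.isAcyclic_iff_forall_adj_isBridge]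
    have cross : ¬ ((joinG v u G H).deleteEdges {s(.inl v, .inr u)}).Reachable (.inl v) (.inr u) := by
      intro hr
      have := reach_closed (fun p : A ⊕ B => p.isLeft = true) ?_ hr rfl
      · simp at this
      · rintro (a | a) (b | b) h ha
        · rfl
        · simp only [SimpleGraph.deleteEdges_adj] at h
          obtain ⟨⟨rfl, rfl⟩, h⟩ := h
          simp at h
        · simp at ha
        · simp at ha
    rintro (a | a) (b | b) h
    · have hb := hGa h
      rw [SimpleGraph.isBridge_iff] at hb ⊢
      intro hr
      apply hb
      refine reach_map (W := A) (H := G.deleteEdges {s(a, b)}) (Sum.elim id (fun _ => v)) ?_ hr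
      rintro (c | c) (d | d) h'
      · apply SimpleGraph.Adj.reachable
        simp only [SimpleGraph.deleteEdges_adj, joinG] at h' ⊢
        refine ⟨h'.1, fun h'' => h'.2 ?_⟩
        simpa using h''
      · simp only [SimpleGraph.deleteEdges_adj, joinG] at h'
        obtain ⟨⟨rfl, rfl⟩, h⟩ := h'
        rfl
      · simp only [SimpleGraph.deleteEdges_adj, joinG] at h'
        obtain ⟨⟨rfl, rfl⟩, h⟩ := h'
        rfl
      · rfl
    · obtain ⟨rfl, rfl⟩ := h
      rw [SimpleGraph.isBridge_iff]
      exact cross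
    · obtain ⟨rfl, rfl⟩ := h
      rw [SimpleGraph.isBridge_iff, Sym2.eq_swap]
      exact fun h => cross h.symm
    · have hb := hHa h
      rw [SimpleGraph.isBridge_iff] at hb ⊢
      intro hr
      apply hb
      refine reach_map (W := B) (H := H.deleteEdges {s(a, b)}) (Sum.elim (fun _ => u) id) ?_ hr
      rintro (c | c) (d | d) h'
      · rfl
      · simp only [SimpleGraph.deleteEdges_adj, joinG] at h'
        obtain ⟨⟨rfl, rfl⟩, h⟩ := h'
        rfl
      · simp only [SimpleGraph.deleteEdges_adj, joinG] at h'
        obtain ⟨⟨rfl, rfl⟩, h⟩ := h'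
        rfl
      · apply SimpleGraph.Adj.reachable
        simp only [SimpleGraph.deleteEdges_adj, joinG] at h' ⊢
        refine ⟨h'.1, fun h'' => h'.2 ?_⟩
        simpa using h''

lemma joinG_comap {A B : Type} (v : A) (u : B) (G : SimpleGraph (A ⊕ B))
    (h : ∀ a b, G.Adj (.inl a) (.inr b) ↔ a = v ∧ b = u) :
    joinG v u (G.comap Sum.inl) (G.comap Sum.inr) = G := by
  ext p q
  rcases p with a | a <;> rcases q with b | b
  · rfl
  · exact (h _ _).symm
  · exact (h _ _).symm.trans (G.adj_comm _ _)
  · rfl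

lemma comap_isTree {A B : Type} (v : A) (u : B) (G : SimpleGraph (A ⊕ B)) (hG : G.IsTree)
    (h : ∀ a b, G.Adj (.inl a) (.inr b) ↔ a = v ∧ b = u) :
    (G.comap Sum.inl).IsTree ∧ (G.comap Sum.inr).IsTree := by
  constructor
  · have : Nonempty A := ⟨v⟩
    refine ⟨⟨fun a b => ?_⟩, SimpleGraph.IsAcyclic.of_comap ⟨Sum.inl, Sum.inl_injective⟩ hG.isAcyclic⟩
    refine reach_map (W := A) (Sum.elim id (fun _ => v)) ?_
      (hG.connected.preconnected (.inl a) (.inl b))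
    rintro (c | c) (d | d) h'
    · exact SimpleGraph.Adj.reachable h'
    · obtain ⟨rfl, rfl⟩ := (h _ _).1 h'
      rfl
    · obtain ⟨rfl, rfl⟩ := (h _ _).1 h'.symm
      rfl
    · rfl
  · have : Nonempty B := ⟨u⟩
    refine ⟨⟨fun a b => ?_⟩, SimpleGraph.IsAcyclic.of_comap ⟨Sum.inr, Sum.inr_injective⟩ hG.isAcyclic⟩
    refine reach_map (W := B) (Sum.elim (fun _ => u) id) ?_
      (hG.connected.preconnected (.inr a) (.inr b))
    rintro (c | c) (d | d) h'
    · rfl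
    · obtain ⟨rfl, rfl⟩ := (h _ _).1 h'
      rfl
    · obtain ⟨rfl, rfl⟩ := (h _ _).1 h'.symm
      rfl
    · exact SimpleGraph.Adj.reachable h'

lemma TW_join {S : Type*} (κ : S → S → ℝ) (hs : ∀ r s, κ r s = κ s r) (h0 : ∀ r s, 0 ≤ κ r s)
    {A B : Type} [Fintype A] [Fintype B] (v : A) (u : B) (x : A → S) (y : B → S) :
    gsum (fun G : SimpleGraph (A ⊕ B) => G.IsTree ∧
      ∀ a b, G.Adj (.inl a) (.inr b) ↔ a = v ∧ b = u) (gw κ (Sum.elim x y)) =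
    κ (x v) (y u) * (TW κ x * TW κ y) := by
  unfold TW
  rw [gsum_filter, gsum_filter, gsum_filter]
  rw [Finset.sum_mul_sum, ← Finset.sum_product', Finset.mul_sum]
  refine Finset.sum_bij' (fun G _ => (G.comap Sum.inl, G.comap Sum.inr))
    (fun p _ => joinG v u p.1 p.2) ?_ ?_ ?_ ?_ ?_
  · intro G hG
    simp only [Finset.mem_filter, Finset.mem_univ, true_and, Finset.mem_product] at hG ⊢
    exact comap_isTree v u G hG.1 hG.2
  · intro p hp
    simp only [Finset.mem_filter, Finset.mem_univ, true_and, Finset.mem_product] at hp ⊢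
    exact ⟨joinG_isTree v u hp.1 hp.2, fun a b => Iff.rfl⟩
  · intro G hG
    simp only [Finset.mem_filter, Finset.mem_univ, true_and] at hG
    exact joinG_comap v u G hG.2
  · intro p hp
    rfl
  · intro G hG
    simp only [Finset.mem_filter, Finset.mem_univ, true_and] at hG
    rw [← gw_join κ hs h0, joinG_comap v u G hG.2]

/-! ### Unique splitting of a tree -/

lemma split_exists {V : Type} {G : SimpleGraph V} (hG : G.IsTree) {v w : V} (hvw : v ≠ w) :
    ∃ (B : Set V) (u : V), v ∉ B ∧ w ∈ B ∧ u ∈ B ∧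
      ∀ a, a ∉ B → ∀ b, b ∈ B → (G.Adj a b ↔ a = v ∧ b = u) := by
  obtain ⟨p, hp⟩ := hG.connected.exists_isPath v w
  cases p with
  | nil => exact absurd rfl hvw
  | @cons _ u _ h q =>
    rw [SimpleGraph.Walk.cons_isPath_iff] at hp
    have hbr := SimpleGraph.isAcyclic_iff_forall_adj_isBridge.1 hG.isAcyclic h
    rw [SimpleGraph.isBridge_iff] at hbr
    have hq : (G.deleteEdges {s(v, u)}).Reachable u w := by
      rw [SimpleGraph.reachable_deleteEdges_iff_exists_walk]
      exact ⟨q, fun h' => hp.2 (q.fst_mem_support_of_mem_edges h')⟩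
    refine ⟨{b | (G.deleteEdges {s(v, u)}).Reachable u b}, u, fun h' => hbr h'.symm, hq,
      SimpleGraph.Reachable.refl _, ?_⟩
    intro a ha b hb
    constructor
    · intro hab
      by_contra hne
      by_cases hs : s(a, b) = s(v, u)
      · rw [Sym2.eq_iff] at hs
        rcases hs with hs | hs
        · exact hne hs
        · rw [Set.mem_ofPred_eq, hs.2] at hb
          exact hbr hb.symm
      · apply ha
        refine SimpleGraph.Reachable.trans hb (SimpleGraph.Adj.reachable ?_)
        rw [SimpleGraph.deleteEdges_adj]
        refine ⟨hab.symm, ?_⟩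
        rw [Sym2.eq_swap (a := b)]
        exact hs
    · rintro ⟨rfl, rfl⟩
      exact h

lemma split_reach {V : Type} {G : SimpleGraph V} (hG : G.IsTree) {v u : V} {B : Set V}
    (hu : u ∈ B) (h : ∀ a, a ∉ B → ∀ b, b ∈ B → (G.Adj a b ↔ a = v ∧ b = u))
    (H : SimpleGraph V) (hH : ∀ a b, a ∈ B → b ∈ B → G.Adj a b → H.Adj a b)
    {w b : V} (hw : w ∈ B) (hb : b ∈ B) : H.Reachable w b := by
  have := reach_map (G := G) (H := H) (fun a => if a ∈ B then a else u) ?_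
    (hG.connected.preconnected w b)
  · simpa [hw, hb] using this
  · intro a b hab
    by_cases ha : a ∈ B <;> by_cases hb : b ∈ B
    · simpa [ha, hb] using (hH a b ha hb hab).reachable
    · obtain ⟨rfl, rfl⟩ := (h b hb a ha).1 hab.symm
      simp [ha, hb]
    · obtain ⟨rfl, rfl⟩ := (h a ha b hb).1 hab
      simp [ha, hb]
    · simp [ha, hb]

lemma split_unique {V : Type} {G : SimpleGraph V} (hG : G.IsTree) {v w u u' : V} {B B' : Set V}
    (hv : v ∉ B) (hw : w ∈ B) (hu : u ∈ B)
    (h : ∀ a, a ∉ B → ∀ b, b ∈ B → (G.Adj a b ↔ a = v ∧ b = u))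
    (hv' : v ∉ B') (hw' : w ∈ B') (hu' : u' ∈ B')
    (h' : ∀ a, a ∉ B' → ∀ b, b ∈ B' → (G.Adj a b ↔ a = v ∧ b = u')) : u = u' ∧ B' ⊆ B := by
  have hcl : ∀ b, (G.deleteEdges {s(v, u)}).Reachable w b → b ∈ B := by
    intro b hb
    refine reach_closed (· ∈ B) ?_ hb hw
    intro a c hac ha
    by_contra hc
    rw [SimpleGraph.deleteEdges_adj] at hac
    obtain ⟨rfl, rfl⟩ := (h c hc a ha).1 hac.1.symm
    exact hac.2 (by rw [Sym2.eq_swap]; rfl)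
  have hr : ∀ b ∈ B', (G.deleteEdges {s(v, u)}).Reachable w b := by
    intro b hb
    refine split_reach hG hu' h' _ ?_ hw' hb
    intro a c ha hc hac
    rw [SimpleGraph.deleteEdges_adj]
    refine ⟨hac, fun hs => ?_⟩
    rw [Set.mem_singleton_iff, Sym2.eq_iff] at hs
    rcases hs with hs | hs
    · exact hv' (hs.1 ▸ ha)
    · exact hv' (hs.2 ▸ hc)
  refine ⟨?_, fun b hb => hcl b (hr b hb)⟩
  by_contra hne
  apply hv
  apply hcl
  refine (hr u' hu').trans (SimpleGraph.Adj.reachable ?_)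
  rw [SimpleGraph.deleteEdges_adj]
  refine ⟨((h' v hv' u' hu').2 ⟨rfl, rfl⟩).symm, fun hs => ?_⟩
  rw [Set.mem_singleton_iff, Sym2.eq_iff] at hs
  rcases hs with hs | hs
  · exact hv' (hs.1 ▸ hu')
  · exact hne hs.1.symm

/-- crossing condition -/
def Cross {ι : Type} (G : SimpleGraph (Option ι)) (B : Finset ι) (u : ι) : Prop :=
  ∀ a : Option ι, (∀ i ∈ B, a ≠ some i) → ∀ b ∈ B, (G.Adj a (some b) ↔ a = none ∧ b = u)

lemma cross_existsUnique {ι : Type} [Fintype ι] {G : SimpleGraph (Option ι)} (hG : G.IsTree)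
    (j : ι) : ∃! p : Finset ι × ι, j ∈ p.1 ∧ p.2 ∈ p.1 ∧ Cross G p.1 p.2 := by
  have key : ∀ p : Finset ι × ι, Cross G p.1 p.2 →
      ∀ a, a ∉ some '' (p.1 : Set ι) → ∀ b, b ∈ some '' (p.1 : Set ι) →
        (G.Adj a b ↔ a = none ∧ b = some p.2) := by
    rintro p hp a ha _ ⟨b, hb, rfl⟩
    rw [hp a (fun i hi h => ha ⟨i, hi, h.symm⟩) b hb]
    simp
  have uniq : ∀ p q : Finset ι × ι, (j ∈ p.1 ∧ p.2 ∈ p.1 ∧ Cross G p.1 p.2) →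
      (j ∈ q.1 ∧ q.2 ∈ q.1 ∧ Cross G q.1 q.2) → p.2 = q.2 ∧ q.1 ⊆ p.1 := by
    intro p q hp hq
    have := split_unique hG (v := none) (w := some j) (u := some p.2) (u' := some q.2)
      (B := some '' (p.1 : Set ι)) (B' := some '' (q.1 : Set ι)) (by simp) ⟨j, hp.1, rfl⟩
      ⟨_, hp.2.1, rfl⟩ (key p hp.2.2) (by simp) ⟨j, hq.1, rfl⟩ ⟨_, hq.2.1, rfl⟩ (key q hq.2.2)
    refine ⟨by simpa using this.1, fun i hi => ?_⟩
    simpa using this.2 ⟨i, hi, rfl⟩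
  refine existsUnique_of_exists_of_unique ?_ ?_
  · obtain ⟨B, u, hv, hw, hu, h⟩ := split_exists hG (v := none) (w := some j) (by simp)
    cases u with
    | none => exact absurd hu hv
    | some u =>
      refine ⟨(Finset.univ.filter (fun i => some i ∈ B), u), by simpa using hw, by simpa using hu, ?_⟩
      intro a ha b hb
      simp only [Finset.mem_filter, Finset.mem_univ, true_and] at ha hb
      rw [h a (fun haB => ?_) _ hb]
      · simp
      · cases a with
        | none => exact hv haB
        | some i => exact ha i haB rfl
  · intro p q hp hq
    have h1 := uniq p q hp hq
    have h2 := uniq q p hq hp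
    exact Prod.ext (h2.2.antisymm h1.2) h1.1

/-- extension of a type vector by a root -/
def rcons {S : Type*} {ι : Type} (r : S) (x : ι → S) : Option ι → S := fun o => o.elim r x

/-- the vertex splitting -/
def splitEquiv {ι : Type} (B : Finset ι) :
    (Option {i // i ∉ B}) ⊕ {i // i ∈ B} ≃ Option ι where
  toFun := Sum.elim (fun o => o.map Subtype.val) (fun i => some i.1)
  invFun o := match o with
    | none => .inl none
    | some i => if h : i ∈ B then .inr ⟨i, h⟩ else .inl (some ⟨i, h⟩)
  left_inv := by
    rintro ((_ | ⟨i, hi⟩) | ⟨i, hi⟩)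
    · rfl
    · simp [hi]
    · simp [hi]
  right_inv := by
    rintro (_ | i)
    · rfl
    · by_cases h : i ∈ B <;> simp [h]

lemma TW_split {S : Type*} (κ : S → S → ℝ) (hs : ∀ r s, κ r s = κ s r) (h0 : ∀ r s, 0 ≤ κ r s)
    {ι : Type} [Fintype ι] (r : S) (x : ι → S) (B : Finset ι) (u : ι) (hu : u ∈ B) :
    gsum (fun G => G.IsTree ∧ Cross G B u) (gw κ (rcons r x)) =
    κ r (x u) * (TW κ (rcons r (fun i : {i // i ∉ B} => x i)) *
      TW κ (fun i : {i // i ∈ B} => x i)) := by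
  have := TW_join κ hs h0 (none : Option {i // i ∉ B}) (⟨u, hu⟩ : {i // i ∈ B})
    (rcons r (fun i : {i // i ∉ B} => x i)) (fun i : {i // i ∈ B} => x i)
  rw [gsum_equiv (splitEquiv B)] at this
  change _ = κ r (x u) * _ at this
  rw [← this]
  refine gsum_congr ?_ ?_
  · intro G
    simp only [isTree_comap]
    refine and_congr Iff.rfl ?_
    constructor
    · intro h a b
      have := h (splitEquiv B (.inl a)) (by
        intro i hi h'
        rcases a with _ | ⟨a, ha⟩
        · cases h'
        · simp only [splitEquiv, Equiv.coe_fn_mk, Sum.elim_inl, Option.map_some,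
            Option.some.injEq] at h'
          exact ha (h' ▸ hi)) b.1 b.2
      refine Iff.trans this ?_
      rcases a with _ | a <;> simp [splitEquiv, Subtype.ext_iff]
    · intro h a ha b hb
      rcases a with _ | a
      · refine Iff.trans (h none ⟨b, hb⟩) (by simp)
      · refine Iff.trans (h (some ⟨a, fun hi => ha a hi rfl⟩) ⟨b, hb⟩) (by simp)
  · intro G _
    rw [← gw_comap κ (splitEquiv B) (rcons r x)]
    congr 1
    ext p
    rcases p with (_ | p) | p <;> rfl

lemma gsum_part {V J : Type} [Fintype V] [Fintype J] (P : SimpleGraph V → Prop)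
    (Q : SimpleGraph V → J → Prop) (f : SimpleGraph V → ℝ) (h : ∀ G, P G → ∃! p, Q G p) :
    gsum P f = ∑ p : J, gsum (fun G => P G ∧ Q G p) f := by
  unfold gsum
  rw [Finset.sum_comm]
  refine Finset.sum_congr rfl fun G _ => ?_
  by_cases hG : P G
  · obtain ⟨p, hp, hpu⟩ := h G hG
    rw [Finset.sum_eq_single p, if_pos hG, if_pos ⟨hG, hp⟩]
    · intro q _ hq
      rw [if_neg]
      exact fun h => hq (hpu q h.2)
    · simp
  · simp [hG]

lemma TW_rec {S : Type*} (κ : S → S → ℝ) (hs : ∀ r s, κ r s = κ s r) (h0 : ∀ r s, 0 ≤ κ r s)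
    {ι : Type} [Fintype ι] (r : S) (x : ι → S) (j : ι) :
    TW κ (rcons r x) = ∑ B : Finset ι, if j ∈ B then
      TW κ (rcons r (fun i : {i // i ∉ B} => x i)) *
      (TW κ (fun i : {i // i ∈ B} => x i) * ∑ i : {i // i ∈ B}, κ r (x i)) else 0 := by
  unfold TW
  rw [gsum_part _ (fun G (p : Finset ι × ι) => j ∈ p.1 ∧ p.2 ∈ p.1 ∧ Cross G p.1 p.2) _
    (fun G hG => cross_existsUnique hG j), Fintype.sum_prod_type]
  refine Finset.sum_congr rfl fun B _ => ?_
  by_cases hj : j ∈ B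
  · rw [if_pos hj]
    rw [← Finset.sum_subtype B (fun _ => Iff.rfl) (fun i => κ r (x i)), Finset.mul_sum,
      Finset.mul_sum]
    rw [← Finset.sum_subset (Finset.subset_univ B)]
    · refine Finset.sum_congr rfl fun u hu => ?_
      have := TW_split κ hs h0 r x B u hu
      simp only [hj, hu, true_and]
      rw [this]
      unfold TW
      ring
    · intro u _ hu
      simp [hu, gsum]
  · rw [if_neg hj]
    simp [hj, gsum]

/-! ### Sums over type vectors -/

/-- rooted sums -/
def AV {S : Type*} [Fintype S] (κ : S → S → ℝ) (θ : S → ℝ) (r : S) (ι : Type) [Fintype ι] : ℝ :=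
  ∑ x : ι → S, TW κ (rcons r x) * ∏ i, θ (x i)

/-- planted sums -/
def BV {S : Type*} [Fintype S] (κ : S → S → ℝ) (θ : S → ℝ) (r : S) (ι : Type) [Fintype ι] : ℝ :=
  ∑ x : ι → S, (TW κ x * ∑ i, κ r (x i)) * ∏ i, θ (x i)

lemma AV_equiv {S : Type*} [Fintype S] (κ : S → S → ℝ) (θ : S → ℝ) (r : S) {ι ι' : Type} [Fintype ι]
    [Fintype ι'] (e : ι ≃ ι') : AV κ θ r ι = AV κ θ r ι' := by
  unfold AV
  rw [← Equiv.sum_comp (e.symm.arrowCongr (Equiv.refl S))]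
  refine Finset.sum_congr rfl fun x _ => ?_
  congr 1
  · rw [← TW_equiv κ (Equiv.optionCongr e)]
    congr 1
    ext o
    cases o <;> simp [rcons]
  · rw [← Equiv.prod_comp e]
    simp

lemma BV_equiv {S : Type*} [Fintype S] (κ : S → S → ℝ) (θ : S → ℝ) (r : S) {ι ι' : Type} [Fintype ι]
    [Fintype ι'] (e : ι ≃ ι') : BV κ θ r ι = BV κ θ r ι' := by
  unfold BV
  rw [← Equiv.sum_comp (e.symm.arrowCongr (Equiv.refl S))]
  refine Finset.sum_congr rfl fun x _ => ?_
  congr 1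
  · congr 1
    · rw [← TW_equiv κ e]
      congr 1
    · rw [← Equiv.sum_comp e]
      simp
  · rw [← Equiv.prod_comp e]
    simp

lemma sum_split {S : Type*} [Fintype S] {ι : Type} [Fintype ι] (θ : S → ℝ) (B : Finset ι)
    (f : ({i // i ∉ B} → S) → ℝ) (g : ({i // i ∈ B} → S) → ℝ) :
    ∑ x : ι → S, (f (fun i => x i) * g (fun i => x i)) * ∏ i, θ (x i) =
    (∑ x : {i // i ∉ B} → S, f x * ∏ i, θ (x i)) *
      (∑ x : {i // i ∈ B} → S, g x * ∏ i, θ (x i)) := by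
  rw [← Equiv.sum_comp (Equiv.piEquivPiSubtypeProd (fun i => i ∈ B) (fun _ => S)).symm,
    Fintype.sum_prod_type, Finset.sum_comm, Finset.sum_mul_sum]
  refine Finset.sum_congr rfl fun x _ => Finset.sum_congr rfl fun y _ => ?_
  have h1 : (fun i : {i // i ∉ B} => (Equiv.piEquivPiSubtypeProd (fun i => i ∈ B)
    (fun _ => S)).symm (y, x) i) = x := by
    ext i; simp [Equiv.piEquivPiSubtypeProd, i.2]
  have h2 : (fun i : {i // i ∈ B} => (Equiv.piEquivPiSubtypeProd (fun i => i ∈ B)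
    (fun _ => S)).symm (y, x) i) = y := by
    ext i; simp [Equiv.piEquivPiSubtypeProd, i.2]
  have h3 : ∏ i, θ ((Equiv.piEquivPiSubtypeProd (fun i => i ∈ B) (fun _ => S)).symm (y, x) i) =
      (∏ i, θ (y i)) * ∏ i, θ (x i) := by
    rw [← Fintype.prod_subtype_mul_prod_subtype (fun i => i ∈ B)]
    congr 1
    · exact Finset.prod_congr (by ext; simp) fun i _ => congrArg θ (congrFun h2 i)
    · exact Finset.prod_congr (by ext; simp) fun i _ => congrArg θ (congrFun h1 i)
  rw [h1, h2, h3]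
  ring

lemma AV_rec {S : Type*} [Fintype S] (κ : S → S → ℝ) (hs : ∀ r s, κ r s = κ s r)
    (h0 : ∀ r s, 0 ≤ κ r s) (θ : S → ℝ) (r : S) (ι : Type) [Fintype ι] :
    (Fintype.card ι : ℝ) * AV κ θ r ι =
      ∑ B : Finset ι, (B.card : ℝ) * (AV κ θ r {i // i ∉ B} * BV κ θ r {i // i ∈ B}) := by
  have h1 : (Fintype.card ι : ℝ) * AV κ θ r ι = ∑ j : ι, AV κ θ r ι := by simp
  rw [h1]
  have h2 : ∀ j : ι, AV κ θ r ι = ∑ B : Finset ι, if j ∈ B then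
      AV κ θ r {i // i ∉ B} * BV κ θ r {i // i ∈ B} else 0 := by
    intro j
    conv_lhs => unfold AV
    simp_rw [TW_rec κ hs h0 r _ j, Finset.sum_mul]
    rw [Finset.sum_comm]
    refine Finset.sum_congr rfl fun B _ => ?_
    split_ifs with hj
    · unfold AV BV
      convert sum_split θ B (fun x => TW κ (rcons r x)) (fun x => TW κ x * ∑ i, κ r (x i))
    · simp
  rw [Finset.sum_congr rfl fun j _ => h2 j, Finset.sum_comm]
  refine Finset.sum_congr rfl fun B _ => ?_
  rw [← Finset.sum_filter]
  simp

lemma AV_rec' {S : Type*} [Fintype S] (κ : S → S → ℝ) (hs : ∀ r s, κ r s = κ s r)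
    (h0 : ∀ r s, 0 ≤ κ r s) (θ : S → ℝ) (r : S) (ι : Type) [Fintype ι] :
    (Fintype.card ι : ℝ) * AV κ θ r ι =
      ∑ B : Finset ι, (B.card : ℝ) * (AV κ θ r (Fin (Fintype.card ι - B.card)) *
        BV κ θ r (Fin B.card)) := by
  rw [AV_rec κ hs h0]
  refine Finset.sum_congr rfl fun B _ => ?_
  congr 2
  · apply AV_equiv
    apply Fintype.equivFinOfCardEq
    rw [Fintype.card_subtype_compl]
    simp
  · apply BV_equiv
    apply Fintype.equivFinOfCardEq
    simp

lemma AV_rec_fin {S : Type*} [Fintype S] (κ : S → S → ℝ) (hs : ∀ r s, κ r s = κ s r)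
    (h0 : ∀ r s, 0 ≤ κ r s) (θ : S → ℝ) (r : S) (n : ℕ) :
    (n : ℝ) * AV κ θ r (Fin n) = ∑ m ∈ Finset.range (n + 1),
      (n.choose m : ℝ) * (m * (AV κ θ r (Fin (n - m)) * BV κ θ r (Fin m))) := by
  have := AV_rec' κ hs h0 θ r (Fin n)
  rw [Fintype.card_fin] at this
  rw [this]
  have h2 := Finset.sum_powerset_apply_card (fun m =>
    (m : ℝ) * (AV κ θ r (Fin (n - m)) * BV κ θ r (Fin m))) (x := (Finset.univ : Finset (Fin n)))
  simp only [Finset.powerset_univ, Finset.card_univ, Fintype.card_fin, nsmul_eq_mul] at h2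
  exact h2

/-- multiplicities -/
def cnt {S : Type*} {n : ℕ} (x : Fin n → S) (s : S) : ℕ :=
  (Finset.univ.filter (fun i => x i = s)).card

/-- degree part of the series -/
def CV {S : Type*} [Fintype S] (κ : S → S → ℝ) (θ : S → ℝ) (n : ℕ) (t : S) : ℝ :=
  ∑ x : Fin n → S, TW κ x * (cnt x t : ℝ) * ∏ i, θ (x i)

lemma BV_eq {S : Type*} [Fintype S] (κ : S → S → ℝ) (θ : S → ℝ) (r : S) (n : ℕ) :
    BV κ θ r (Fin n) = ∑ t, κ r t * CV κ θ n t := by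
  unfold BV CV
  simp_rw [Finset.mul_sum]
  rw [Finset.sum_comm]
  refine Finset.sum_congr (by ext; simp) fun x _ => ?_
  have : ∑ i, κ r (x i) = ∑ t, κ r t * (cnt x t : ℝ) := by
    rw [← Finset.sum_fiberwise (s := Finset.univ) (g := x)]
    refine Finset.sum_congr rfl fun t _ => ?_
    rw [Finset.sum_congr rfl (g := fun _ => κ r t)]
    · simp [cnt, mul_comm]
    · intro i hi
      rw [(Finset.mem_filter.1 hi).2]
  rw [← Finset.mul_sum, this, Finset.mul_sum, Finset.sum_mul]
  exact Finset.sum_congr rfl fun t _ => by ring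

lemma sum_option {S : Type*} [Fintype S] (κ : S → S → ℝ) (θ : S → ℝ) (r : S) (ι : Type) [Fintype ι] :
    ∑ y : Option ι → S, (if y none = r then TW κ y * ∏ i, θ (y i) else 0) =
    θ r * AV κ θ r ι := by
  rw [← Equiv.sum_comp (Equiv.piOptionEquivProd (β := fun _ => S)).symm, Fintype.sum_prod_type,
    Finset.sum_eq_single r]
  · unfold AV
    rw [Finset.mul_sum]
    refine Finset.sum_congr rfl fun x _ => ?_
    have : (Equiv.piOptionEquivProd (β := fun _ => S)).symm (r, x) = rcons r x := by
      ext o; cases o <;> rfl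
    rw [this, Fintype.prod_option, if_pos (show rcons r x none = r from rfl)]
    simp only [rcons, Option.elim]
    ring
  · intro s _ hsr
    refine Finset.sum_eq_zero fun x _ => if_neg ?_
    exact hsr
  · simp

lemma CV_succ {S : Type*} [Fintype S] (κ : S → S → ℝ) (θ : S → ℝ) (r : S) (n : ℕ) :
    CV κ θ (n + 1) r = (n + 1 : ℝ) * (θ r * AV κ θ r (Fin n)) := by
  have h1 : CV κ θ (n + 1) r = ∑ i : Fin (n + 1), ∑ x : Fin (n + 1) → S,
      if x i = r then TW κ x * ∏ i, θ (x i) else 0 := by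
    unfold CV
    rw [Finset.sum_comm]
    refine Finset.sum_congr rfl fun x _ => ?_
    rw [← Finset.sum_filter, Finset.sum_const, nsmul_eq_mul, cnt]
    ring
  rw [h1]
  have h2 : ∀ i : Fin (n + 1), (∑ x : Fin (n + 1) → S,
      if x i = r then TW κ x * ∏ i, θ (x i) else 0) = θ r * AV κ θ r (Fin n) := by
    intro i
    rw [← sum_option]
    refine Finset.sum_equiv ((finSuccEquiv' i).arrowCongr (Equiv.refl S)) (by simp) fun x _ => ?_
    have e1 : ((finSuccEquiv' i).arrowCongr (Equiv.refl S)) x none = x i := by simp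
    have e2 : TW κ (((finSuccEquiv' i).arrowCongr (Equiv.refl S)) x) = TW κ x := by
      rw [← TW_equiv κ (finSuccEquiv' i)]
      congr 1
      ext j; simp
    have e3 : ∏ o, θ (((finSuccEquiv' i).arrowCongr (Equiv.refl S)) x o) = ∏ i, θ (x i) := by
      rw [← Equiv.prod_comp (finSuccEquiv' i)]
      simp
    rw [e1, e2, e3]
  rw [Finset.sum_congr rfl fun i _ => h2 i]
  simp

/-! ### Comparison with `treeWeight` -/

lemma graphOf_adj {n : ℕ} {E : Finset (Fin n × Fin n)} (hE : E ⊆ upperPairs n) (i j : Fin n) :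
    (graphOf E).Adj i j ↔ (i, j) ∈ E ∨ (j, i) ∈ E := by
  unfold graphOf
  rw [SimpleGraph.fromRel_adj]
  constructor
  · exact fun h => h.2
  · intro h
    refine ⟨?_, h⟩
    rintro rfl
    have := hE (h.elim id id)
    simp [upperPairs] at this

lemma gw_graphOf {S : Type*} (κ : S → S → ℝ) (hs : ∀ r s, κ r s = κ s r) (h0 : ∀ r s, 0 ≤ κ r s)
    {n : ℕ} (x : Fin n → S) {E : Finset (Fin n × Fin n)} (hE : E ⊆ upperPairs n) :
    gw κ x (graphOf E) = ∏ q ∈ E, κ (x q.1) (x q.2) := by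
  unfold gw
  rw [← Fintype.prod_prod_type' (f := fun i j => if (graphOf E).Adj i j then
    √(κ (x i) (x j)) else 1)]
  have h1 : ∀ p : Fin n × Fin n, (if (graphOf E).Adj p.1 p.2 then √(κ (x p.1) (x p.2)) else 1) =
      (if p ∈ E then √(κ (x p.1) (x p.2)) else 1) *
      (if p.swap ∈ E then √(κ (x p.swap.1) (x p.swap.2)) else 1) := by
    rintro ⟨i, j⟩
    simp only [graphOf_adj hE, Prod.swap]
    by_cases h1 : (i, j) ∈ E <;> by_cases h2 : (j, i) ∈ E
    · exfalso
      have a1 := hE h1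
      have a2 := hE h2
      simp only [upperPairs, Finset.mem_filter, Finset.mem_univ, true_and] at a1 a2
      exact lt_asymm a1 a2
    · simp [h1, h2]
    · simp [h1, h2, hs (x i) (x j)]
    · simp [h1, h2]
  rw [Finset.prod_congr rfl fun p _ => h1 p, Finset.prod_mul_distrib]
  have h2 : (∏ p : Fin n × Fin n, if p.swap ∈ E then √(κ (x p.swap.1) (x p.swap.2)) else 1) =
      ∏ p : Fin n × Fin n, if p ∈ E then √(κ (x p.1) (x p.2)) else 1 :=
    Equiv.prod_comp (Equiv.prodComm (Fin n) (Fin n))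
      (fun p => if p ∈ E then √(κ (x p.1) (x p.2)) else 1)
  rw [h2, Finset.prod_ite_mem, Finset.univ_inter, ← Finset.prod_mul_distrib]
  exact Finset.prod_congr rfl fun q _ => Real.mul_self_sqrt (h0 _ _)

lemma graphOf_card {n : ℕ} {E : Finset (Fin n × Fin n)} (hE : E ⊆ upperPairs n) :
    Nat.card (graphOf E).edgeSet = E.card := by
  have h1 : (graphOf E).edgeSet = (fun q : Fin n × Fin n => s(q.1, q.2)) '' (E : Set (Fin n × Fin n)) := by
    ext e
    induction e with
    | h a b =>
      rw [SimpleGraph.mem_edgeSet, graphOf_adj hE]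
      constructor
      · rintro (h | h)
        · exact ⟨(a, b), h, rfl⟩
        · exact ⟨(b, a), h, Sym2.eq_swap⟩
      · rintro ⟨⟨c, d⟩, h, h'⟩
        simp only [Sym2.eq_iff] at h'
        rcases h' with ⟨rfl, rfl⟩ | ⟨rfl, rfl⟩
        · exact Or.inl h
        · exact Or.inr h
  rw [h1, Nat.card_coe_set_eq, Set.InjOn.ncard_image, Set.ncard_coe_finset]
  rintro ⟨a, b⟩ hab ⟨c, d⟩ hcd h
  have a1 := hE hab
  have a2 := hE hcd
  simp only [upperPairs, Finset.mem_filter, Finset.mem_univ, true_and] at a1 a2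
  simp only [Sym2.eq_iff] at h
  rcases h with ⟨rfl, rfl⟩ | ⟨rfl, rfl⟩
  · rfl
  · exact absurd a1 (lt_asymm a2)

lemma treeWeight_eq {S : Type*} (κ : S → S → ℝ) (hs : ∀ r s, κ r s = κ s r)
    (h0 : ∀ r s, 0 ≤ κ r s) (n : ℕ) (x : Fin n → S) : treeWeight n x κ = TW κ x := by
  unfold treeWeight TW
  rw [gsum_filter]
  have hU : ∀ G : SimpleGraph (Fin n), (Finset.univ.filter
      (fun q : Fin n × Fin n => q.1 < q.2 ∧ G.Adj q.1 q.2)) ⊆ upperPairs n := by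
    intro G q hq
    simp only [upperPairs, Finset.mem_filter, Finset.mem_univ, true_and] at hq ⊢
    exact hq.1
  have hinv : ∀ G : SimpleGraph (Fin n), graphOf (Finset.univ.filter
      (fun q : Fin n × Fin n => q.1 < q.2 ∧ G.Adj q.1 q.2)) = G := by
    intro G
    ext a b
    rw [graphOf_adj (hU G)]
    simp only [Finset.mem_filter, Finset.mem_univ, true_and]
    constructor
    · rintro (h | h)
      · exact h.2
      · exact h.2.symm
    · intro h
      rcases lt_or_gt_of_ne h.ne with h' | h'
      · exact Or.inl ⟨h', h⟩
      · exact Or.inr ⟨h', h.symm⟩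
  have hT : ∀ E : Finset (Fin n × Fin n), E ⊆ upperPairs n →
      ((graphOf E).IsTree ↔ (graphOf E).Connected ∧ E.card + 1 = n) := by
    intro E hE
    rw [SimpleGraph.isTree_iff_connected_and_card, graphOf_card hE, Nat.card_fin]
  refine Finset.sum_bij' (fun E _ => graphOf E) (fun G _ => Finset.univ.filter
      (fun q : Fin n × Fin n => q.1 < q.2 ∧ G.Adj q.1 q.2)) ?_ ?_ ?_ ?_ ?_
  · intro E hE
    rw [Finset.mem_filter, Finset.mem_powerset] at hE
    simpa using (hT E hE.1).2 hE.2
  · intro G hG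
    rw [Finset.mem_filter, Finset.mem_powerset]
    refine ⟨hU G, (hT _ (hU G)).1 ?_⟩
    rw [hinv]
    simpa using hG
  · intro E hE
    rw [Finset.mem_filter, Finset.mem_powerset] at hE
    ext ⟨a, b⟩
    simp only [Finset.mem_filter, Finset.mem_univ, true_and, graphOf_adj hE.1]
    constructor
    · rintro ⟨h1, h2 | h2⟩
      · exact h2
      · have := hE.1 h2
        simp only [upperPairs, Finset.mem_filter, Finset.mem_univ, true_and] at this
        exact absurd h1 (lt_asymm this)
    · intro h
      have := hE.1 h
      simp only [upperPairs, Finset.mem_filter, Finset.mem_univ, true_and] at this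
      exact ⟨this, Or.inl h⟩
  · intro G _
    exact hinv G
  · intro E hE
    rw [Finset.mem_filter, Finset.mem_powerset] at hE
    exact (gw_graphOf κ hs h0 x hE.1).symm

/-! ### Multiplicities -/

lemma cnt_compatVec {S : Type*} [Fintype S] (k : S → ℕ) : cnt (compatVec k) = k := by
  ext s
  have h1 : List.ofFn (compatVec k) = compatList k := by
    apply List.ext_get
    · simp [compatList_length]
    · intro n h1 h2
      simp [compatVec]
  have h2 : cnt (compatVec k) s = (List.ofFn (compatVec k)).count s := by
    rw [← Multiset.coe_count, ← Fin.univ_val_map, Multiset.count_map, cnt, Finset.card_def,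
      Finset.filter_val]
    congr 1
    exact Multiset.filter_congr fun i _ => eq_comm
  rw [h2, h1, ← Multiset.coe_count, compatList, Multiset.coe_toList, Multiset.count_sum']
  simp [Multiset.count_singleton]

lemma exists_perm {S : Type*} {n : ℕ} (x y : Fin n → S) (h : cnt x = cnt y) :
    ∃ e : Fin n ≃ Fin n, y ∘ e = x := by
  have hc : ∀ s, Nonempty ({a // x a = s} ≃ {b // y b = s}) := by
    intro s
    rw [← Fintype.card_eq, Fintype.card_subtype, Fintype.card_subtype]
    have := congrFun h s
    unfold cnt at this
    exact this
  let e := fun s => (hc s).some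
  exact ⟨Equiv.ofFiberEquiv e, funext fun a => Equiv.ofFiberEquiv_map e a⟩

lemma TW_cnt {S : Type*} (κ : S → S → ℝ) {n : ℕ} (x y : Fin n → S) (h : cnt x = cnt y) :
    TW κ x = TW κ y := by
  obtain ⟨e, rfl⟩ := exists_perm x y h
  exact TW_equiv κ e y

lemma cnt_comp {S : Type*} {n : ℕ} (x : Fin n → S) (e : Fin n ≃ Fin n) : cnt (x ∘ e) = cnt x := by
  ext s
  unfold cnt
  exact Finset.card_equiv e (by simp)

lemma sum_cnt {S : Type*} [Fintype S] {n : ℕ} (x : Fin n → S) : ∑ s, cnt x s = n := by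
  have := Finset.card_eq_sum_card_fiberwise (f := x) (s := Finset.univ) (t := Finset.univ) (by simp)
  simpa [cnt] using this.symm

lemma prod_cnt {S : Type*} [Fintype S] (θ : S → ℝ) {n : ℕ} (x : Fin n → S) :
    ∏ i, θ (x i) = ∏ s, θ s ^ cnt x s := by
  rw [← Finset.prod_fiberwise (s := Finset.univ) (g := x)]
  refine Finset.prod_congr rfl fun s _ => ?_
  rw [cnt, Finset.prod_congr rfl (g := fun _ => θ s), Finset.prod_const]
  intro i hi
  rw [(Finset.mem_filter.1 hi).2]

lemma count_vec {S : Type*} [Fintype S] (n : ℕ) (x₀ : Fin n → S) :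
    (Finset.univ.filter (fun x : Fin n → S => cnt x = cnt x₀)).card *
      ∏ s, (cnt x₀ s).factorial = n.factorial := by
  have h1 : Fintype.card {g : Equiv.Perm (Fin n) // x₀ ∘ g = x₀} = ∏ s, (cnt x₀ s).factorial := by
    rw [DomMulAct.stabilizer_card]
    refine Finset.prod_congr rfl fun s _ => ?_
    rw [Fintype.card_subtype, cnt]
  have h2 := Finset.card_eq_sum_card_fiberwise (f := fun g : Equiv.Perm (Fin n) => x₀ ∘ g)
    (s := Finset.univ) (t := Finset.univ.filter (fun x : Fin n → S => cnt x = cnt x₀)) (by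
      intro g _
      simp [cnt_comp])
  rw [Finset.card_univ, Fintype.card_perm, Fintype.card_fin] at h2
  rw [h2, ← smul_eq_mul, ← Finset.sum_const]
  refine Finset.sum_congr rfl fun x hx => ?_
  obtain ⟨e, rfl⟩ := exists_perm x x₀ (by simpa using hx)
  rw [← h1, Fintype.card_subtype]
  refine Finset.card_equiv (Equiv.mulRight (e : Equiv.Perm (Fin n))) ?_
  intro g
  simp only [Finset.mem_filter, Finset.mem_univ, true_and, Equiv.coe_mulRight, Equiv.Perm.coe_mul]
  constructor
  · intro h
    rw [← Function.comp_assoc, h]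
  · intro h
    ext i
    have := congrFun h (e.symm i)
    simpa using this

/-! ### Analysis -/

lemma exp_series (a b : ℕ → ℝ) (ha : ∀ n, 0 ≤ a n) (hb : ∀ n, 0 ≤ b n) (sa : Summable a)
    (sb : Summable b) (a0 : a 0 = 1) (b0 : b 0 = 0)
    (hrec : ∀ n : ℕ, (n : ℝ) * a n = ∑ m ∈ Finset.range (n + 1), ((m : ℝ) * b m) * a (n - m)) :
    ∑' n, a n = Real.exp (∑' n, b n) := by
  have key : ∀ c : ℕ → ℝ, (∀ n, 0 ≤ c n) → Summable c → ∀ t ∈ Set.Ioo (0:ℝ) 1,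
      Summable (fun n : ℕ => (n : ℝ) * c n * t ^ (n - 1)) ∧
      HasDerivAt (fun t : ℝ => ∑' n, c n * t ^ n) (∑' n : ℕ, (n : ℝ) * c n * t ^ (n - 1)) t := by
    intro c hc sc t ht
    obtain ⟨ρ, h1, h2⟩ := exists_between ht.2
    have hρ0 : 0 < ρ := ht.1.trans h1
    have hcb : ∀ n, c n ≤ ∑' n, c n := fun n => sc.le_tsum n (fun j _ => hc j)
    have su : Summable (fun n : ℕ => (∑' n, c n) * ((n : ℝ) * ρ ^ (n - 1))) := by
      apply Summable.mul_left
      rw [← summable_nat_add_iff 1]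
      have e1 := summable_pow_mul_geometric_of_norm_lt_one (R := ℝ) 1 (r := ρ) (by
        rw [Real.norm_eq_abs, abs_of_pos hρ0]; exact h2)
      have e0 := summable_pow_mul_geometric_of_norm_lt_one (R := ℝ) 0 (r := ρ) (by
        rw [Real.norm_eq_abs, abs_of_pos hρ0]; exact h2)
      refine (e1.add e0).congr fun n => ?_
      simp
      ring
    have bd : ∀ (n : ℕ) (y : ℝ), |y| < ρ → ‖(n : ℝ) * c n * y ^ (n - 1)‖ ≤
        (∑' n, c n) * ((n : ℝ) * ρ ^ (n - 1)) := by
      intro n y hy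
      rw [norm_mul, norm_mul, norm_pow, Real.norm_eq_abs, Real.norm_eq_abs, Real.norm_eq_abs,
        abs_of_nonneg (hc n), abs_of_nonneg (Nat.cast_nonneg n)]
      calc (n : ℝ) * c n * |y| ^ (n - 1) ≤ n * (∑' n, c n) * ρ ^ (n - 1) := by
            have := hcb n
            have := hc n
            have : 0 ≤ ∑' n, c n := tsum_nonneg hc
            gcongr
        _ = _ := by ring
    have htρ : |t| < ρ := by rw [abs_of_pos ht.1]; exact h1
    refine ⟨Summable.of_norm_bounded su fun n => bd n t htρ, ?_⟩
    refine hasDerivAt_tsum_of_isPreconnected (t := Metric.ball (0:ℝ) ρ) (y₀ := 0) su Metric.isOpen_ball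
      (convex_ball (0:ℝ) ρ).isPreconnected (g := fun n t => c n * t ^ n)
      (g' := fun n t => (n : ℝ) * c n * t ^ (n - 1)) ?_ ?_ ?_ ?_ ?_
    · intro n y _
      have := (hasDerivAt_pow n y).const_mul (c n)
      exact this.congr_deriv (by ring)
    · intro n y hy
      exact bd n y (by simpa using hy)
    · simpa using hρ0
    · refine summable_of_ne_finset_zero (s := {0}) ?_
      intro n hn
      have : n ≠ 0 := by simpa using hn
      simp [this]
    · simpa using htρ
  have cont : ∀ c : ℕ → ℝ, (∀ n, 0 ≤ c n) → Summable c →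
      ContinuousOn (fun t : ℝ => ∑' n, c n * t ^ n) (Set.Icc 0 1) := by
    intro c hc sc
    refine continuousOn_tsum (u := c) (fun n => by fun_prop) sc ?_
    intro n t ht
    rw [norm_mul, norm_pow, Real.norm_eq_abs, Real.norm_eq_abs, abs_of_nonneg (hc n),
      abs_of_nonneg ht.1]
    exact mul_le_of_le_one_right (hc n) (pow_le_one₀ ht.1 ht.2)
  have smul : ∀ c : ℕ → ℝ, (∀ n, 0 ≤ c n) → Summable c → ∀ t ∈ Set.Ioo (0:ℝ) 1,
      Summable (fun n => c n * t ^ n) := by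
    intro c hc sc t ht
    refine Summable.of_nonneg_of_le (fun n => mul_nonneg (hc n) (pow_nonneg ht.1.le _)) ?_ sc
    intro n
    exact mul_le_of_le_one_right (hc n) (pow_le_one₀ ht.1.le ht.2.le)
  set f := fun t : ℝ => ∑' n, a n * t ^ n with hf
  set g := fun t : ℝ => ∑' n, b n * t ^ n with hg
  have ode : ∀ t ∈ Set.Ioo (0:ℝ) 1, (∑' n : ℕ, (n : ℝ) * a n * t ^ (n - 1)) =
      (∑' n : ℕ, (n : ℝ) * b n * t ^ (n - 1)) * f t := by
    intro t ht
    have tm : ∀ c : ℕ → ℝ, t * (∑' n : ℕ, (n : ℝ) * c n * t ^ (n - 1)) =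
        ∑' n : ℕ, (n : ℝ) * c n * t ^ n := by
      intro c
      rw [← tsum_mul_left]
      refine tsum_congr fun n => ?_
      rcases n with _ | n
      · simp
      · simp only [Nat.add_sub_cancel]
        ring
    have sm : Summable (fun n : ℕ => (n : ℝ) * b n * t ^ n) := by
      refine ((key b hb sb t ht).1.mul_left t).congr fun n => ?_
      rcases n with _ | n
      · simp
      · simp only [Nat.add_sub_cancel]
        ring
    apply mul_left_cancel₀ ht.1.ne'
    rw [tm a, ← mul_assoc, tm b, hf]
    simp only
    rw [tsum_mul_tsum_eq_tsum_sum_range_of_summable_norm sm.norm (smul a ha sa t ht).norm]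
    refine tsum_congr fun n => ?_
    rw [hrec, Finset.sum_mul]
    refine Finset.sum_congr rfl fun m hm => ?_
    have : t ^ n = t ^ m * t ^ (n - m) := by
      rw [← pow_add, Nat.add_sub_cancel' (Nat.lt_succ_iff.1 (Finset.mem_range.1 hm))]
    rw [this]
    ring
  have hcst : ∀ x ∈ Set.Icc (0:ℝ) 1, (fun t => f t * Real.exp (-g t)) x =
      (fun t => f t * Real.exp (-g t)) 0 := by
    have hc : ContinuousOn (fun t => f t * Real.exp (-g t)) (Set.Icc 0 1) :=
      (cont a ha sa).mul (Real.continuous_exp.comp_continuousOn (cont b hb sb).neg)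
    have hd : ∀ t ∈ Set.Ioo (0:ℝ) 1, HasDerivAt (fun t => f t * Real.exp (-g t)) 0 t := by
      intro t ht
      have h1 := (key a ha sa t ht).2
      have h2 := (key b hb sb t ht).2
      have h3 := h1.mul h2.neg.exp
      refine h3.congr_deriv ?_
      rw [ode t ht]
      simp only [hf]
      ring
    intro x hx
    rcases eq_or_lt_of_le hx.1 with h | h
    · rw [← h]
    · obtain ⟨c, hc1, hc2⟩ := exists_hasDerivAt_eq_slope (fun t => f t * Real.exp (-g t)) (fun _ => 0) h
        (hc.mono (Set.Icc_subset_Icc_right hx.2))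
        (fun t ht => hd t ⟨ht.1, ht.2.trans_le hx.2⟩)
      rw [eq_div_iff (by linarith)] at hc2
      linarith
  have h1 := hcst 1 (by simp)
  have hz : ∀ c : ℕ → ℝ, ∑' n, c n * (0:ℝ) ^ n = c 0 := by
    intro c
    rw [tsum_eq_single 0]
    · simp
    · intro n hn
      simp [hn]
  simp only [hf, hg, hz, a0, b0, one_pow, mul_one, neg_zero, Real.exp_zero, Real.exp_neg] at h1
  field_simp at h1
  exact h1

/-! ### The series -/

lemma TW_nonneg {S : Type*} (κ : S → S → ℝ) {V : Type} [Fintype V] (x : V → S) : 0 ≤ TW κ x := by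
  unfold TW gsum gw
  refine Finset.sum_nonneg fun G _ => ?_
  split_ifs
  · refine Finset.prod_nonneg fun i _ => Finset.prod_nonneg fun j _ => ?_
    split_ifs
    · exact Real.sqrt_nonneg _
    · exact zero_le_one
  · exact le_rfl

lemma TW_tau {S : Type*} [Fintype S] (κ : S → S → ℝ) (hs : ∀ r s, κ r s = κ s r)
    (h0 : ∀ r s, 0 ≤ κ r s) (k : S → ℕ) (n : ℕ) (h : n = ∑ s, k s) (x : Fin n → S)
    (hx : cnt x = k) : TW κ x = tau κ k := by
  subst h
  rw [tau, treeWeight_eq κ hs h0]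
  exact TW_cnt κ _ _ (hx.trans (cnt_compatVec k).symm)

lemma CV_term_nonneg {S : Type*} [Fintype S] (κ : S → S → ℝ) (θ : S → ℝ)
    (hθ : ∀ s, 0 ≤ θ s) (n : ℕ) (t : S) (x : Fin n → S) :
    0 ≤ TW κ x * (cnt x t : ℝ) * ∏ i, θ (x i) :=
  mul_nonneg (mul_nonneg (TW_nonneg κ x) (Nat.cast_nonneg _)) (Finset.prod_nonneg fun i _ => hθ _)

lemma CV_nonneg {S : Type*} [Fintype S] (κ : S → S → ℝ) (θ : S → ℝ)
    (hθ : ∀ s, 0 ≤ θ s) (n : ℕ) (t : S) : 0 ≤ CV κ θ n t :=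
  Finset.sum_nonneg fun x _ => CV_term_nonneg κ θ hθ n t x

lemma count_vec' {S : Type*} [Fintype S] (k : S → ℕ) :
    (Finset.univ.filter (fun x : Fin (∑ s, k s) → S => cnt x = k)).card *
      ∏ s, (k s).factorial = (∑ s, k s).factorial := by
  have := count_vec _ (compatVec k)
  rwa [cnt_compatVec] at this

lemma Gamma0_eq {S : Type*} [Fintype S] (κ : S → S → ℝ) (hs : ∀ r s, κ r s = κ s r)
    (h0 : ∀ r s, 0 ≤ κ r s) (θ : S → ℝ) (hθ : ∀ s, 0 ≤ θ s) (t : S) :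
    Gamma0 κ θ t = ∑' n, ENNReal.ofReal (CV κ θ n t / n.factorial) := by
  let G : ℕ → (S → ℕ) → ℝ := fun n k => tau κ k * (k t : ℝ) * (∏ s, θ s ^ k s) / n.factorial
  have hH : ∀ (n : ℕ) (x : Fin n → S), TW κ x * (cnt x t : ℝ) * (∏ i, θ (x i)) / n.factorial =
      G n (cnt x) := by
    intro n x
    simp only [G]
    rw [TW_tau κ hs h0 (cnt x) n (sum_cnt x).symm x rfl, prod_cnt]
  have h1 : ∀ n, ENNReal.ofReal (CV κ θ n t / n.factorial) =
      ∑' k : S → ℕ, ∑ x : Fin n → S, if cnt x = k then ENNReal.ofReal (G n k) else 0 := by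
    intro n
    rw [CV, Finset.sum_div, ENNReal.ofReal_sum_of_nonneg
      (fun x _ => div_nonneg (CV_term_nonneg κ θ hθ n t x) (Nat.cast_nonneg _)),
      Summable.tsum_finsetSum (fun _ _ => ENNReal.summable)]
    refine Finset.sum_congr rfl fun x _ => ?_
    rw [hH, tsum_eq_single (cnt x)]
    · rw [if_pos rfl]
    · intro k hk
      rw [if_neg hk.symm]
  rw [tsum_congr h1, ENNReal.tsum_comm, Gamma0]
  refine tsum_congr fun k => ?_
  rw [tsum_eq_single (∑ s, k s)]
  · rw [← Finset.sum_filter, Finset.sum_const, ← ENNReal.ofReal_nsmul, nsmul_eq_mul]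
    congr 1
    have hc : ((Finset.univ.filter (fun x : Fin (∑ s, k s) → S => cnt x = k)).card : ℝ) *
      ∏ s, ((k s).factorial : ℝ) = ((∑ s, k s).factorial : ℝ) := by
      exact_mod_cast count_vec' k
    have hp : ∏ s, ((k s).factorial : ℝ) ≠ 0 :=
      Finset.prod_ne_zero_iff.2 fun s _ => by positivity
    have hq : ((∑ s, k s).factorial : ℝ) ≠ 0 := by positivity
    simp only [G]
    rw [Finset.prod_div_distrib, ← mul_div_assoc, ← mul_div_assoc, div_eq_div_iff hp hq, ← hc]
    ring
  · intro n hn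
    refine Finset.sum_eq_zero fun x _ => ?_
    rw [if_neg]
    rintro rfl
    exact hn (sum_cnt x).symm

lemma AV_zero {S : Type*} [Fintype S] (κ : S → S → ℝ) (θ : S → ℝ) (r : S) :
    AV κ θ r (Fin 0) = 1 := by
  have hsub : Subsingleton (Option (Fin 0)) := ⟨by rintro (_ | a) (_ | b) <;> first | rfl | exact a.elim0 | exact b.elim0⟩
  have key : ∀ x : Option (Fin 0) → S, TW κ x = 1 := by
    intro x
    unfold TW gsum
    have : ∀ G : SimpleGraph (Option (Fin 0)), G = ⊥ := fun G => Subsingleton.elim _ _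
    rw [Finset.sum_eq_single (⊥ : SimpleGraph (Option (Fin 0))) (fun b _ hb => absurd (this b) hb)
      (by simp), if_pos SimpleGraph.IsTree.of_subsingleton]
    simp [gw]
  unfold AV
  simp [key]

lemma CV_zero {S : Type*} [Fintype S] (κ : S → S → ℝ) (θ : S → ℝ) (r : S) :
    CV κ θ 0 r = 0 := by
  simp [CV, cnt]

theorem main_aux {S : Type*} [Fintype S]
    (κ : S → S → ℝ) (hs : ∀ r s, κ r s = κ s r) (h0 : ∀ r s, 0 ≤ κ r s)
    (θ : S → ℝ) (hθ : ∀ s, 0 ≤ θ s)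
    (hfin : ∀ r, Gamma0 κ θ r ≠ ⊤) (r : S) :
    (Gamma0 κ θ r).toReal = θ r * Real.exp (∑ s : S, κ r s * (Gamma0 κ θ s).toReal) := by
  have hnn : ∀ (t : S) (n : ℕ), 0 ≤ CV κ θ n t / n.factorial := fun t n =>
    div_nonneg (CV_nonneg κ θ hθ n t) (Nat.cast_nonneg _)
  have hsum : ∀ t, Summable (fun n => CV κ θ n t / n.factorial) := by
    intro t
    have h := hfin t
    rw [Gamma0_eq κ hs h0 θ hθ] at h
    refine (ENNReal.summable_toReal h).congr fun n => ?_
    rw [ENNReal.toReal_ofReal (hnn t n)]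
  have hG : ∀ t, (Gamma0 κ θ t).toReal = ∑' n, CV κ θ n t / n.factorial := by
    intro t
    rw [Gamma0_eq κ hs h0 θ hθ, ← ENNReal.ofReal_tsum_of_nonneg (hnn t) (hsum t),
      ENNReal.toReal_ofReal (tsum_nonneg (hnn t))]
  have hsucc : ∀ n : ℕ, CV κ θ (n + 1) r / (n + 1).factorial =
      θ r * (AV κ θ r (Fin n) / n.factorial) := by
    intro n
    rw [CV_succ, Nat.factorial_succ]
    push_cast
    field_simp
  have hGr : (Gamma0 κ θ r).toReal = ∑' n : ℕ, θ r * (AV κ θ r (Fin n) / n.factorial) := by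
    rw [hG, (hsum r).tsum_eq_zero_add, CV_zero, zero_div, zero_add]
    exact tsum_congr hsucc
  rcases eq_or_ne (θ r) 0 with hr | hr
  · rw [hGr, hr]
    simp
  rw [hGr, tsum_mul_left]
  congr 1
  have hBV : ∀ n : ℕ, BV κ θ r (Fin n) / n.factorial =
      ∑ t, κ r t * (CV κ θ n t / n.factorial) := by
    intro n
    rw [BV_eq, Finset.sum_div]
    exact Finset.sum_congr rfl fun t _ => mul_div_assoc _ _ _
  have hB : ∑ s : S, κ r s * (Gamma0 κ θ s).toReal = ∑' n : ℕ, BV κ θ r (Fin n) / n.factorial := by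
    rw [tsum_congr hBV, Summable.tsum_finsetSum (fun t _ => (hsum t).mul_left _)]
    refine Finset.sum_congr rfl fun t _ => ?_
    rw [hG, tsum_mul_left]
  rw [hB]
  refine exp_series _ _ ?_ ?_ ?_ ?_ ?_ ?_ ?_
  · intro n
    refine div_nonneg ?_ (Nat.cast_nonneg _)
    exact Finset.sum_nonneg fun x _ => mul_nonneg (TW_nonneg κ _) (Finset.prod_nonneg fun i _ => hθ _)
  · intro n
    rw [hBV]
    exact Finset.sum_nonneg fun t _ => mul_nonneg (h0 _ _) (hnn t n)
  · have h := (summable_nat_add_iff 1).2 (hsum r)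
    have h2 : Summable (fun n : ℕ => θ r * (AV κ θ r (Fin n) / n.factorial)) := h.congr hsucc
    exact (summable_mul_left_iff hr).1 h2
  · refine Summable.congr ?_ (fun n => (hBV n).symm)
    exact summable_sum fun t _ => (hsum t).mul_left _
  · simp [AV_zero]
  · rw [hBV]
    simp [CV_zero]
  · intro n
    rw [← mul_div_assoc, AV_rec_fin κ hs h0, Finset.sum_div]
    refine Finset.sum_congr rfl fun m hm => ?_
    rw [Nat.cast_choose ℝ (Nat.lt_succ_iff.1 (Finset.mem_range.1 hm))]
    field_simp
/-- the functional equation `Γ_r(θ) = θ_r exp((κ Γ(θ))_r)`. -/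
theorem Gamma_functional_equation
    {S : Type*} [Fintype S] [DecidableEq S] [Nonempty S]
    (κ : S → S → ℝ) (hκsym : ∀ r s, κ r s = κ s r) (hκ0 : ∀ r s, 0 ≤ κ r s)
    (θ : S → ℝ) (hθ : ∀ s, 0 ≤ θ s)
    (hfin : ∀ r, Gamma0 κ θ r ≠ ⊤) (r : S) :
    (Gamma0 κ θ r).toReal = θ r * Real.exp (∑ s : S, κ r s * (Gamma0 κ θ s).toReal) := by
  exact main_aux κ hκsym hκ0 θ hθ hfin r


end
end

section
/- Let κ be a kernel on S and θ ∈ [0,∞)^S. If χ(κ,θ) > 1, then Γ_r(θ) < ∞ for every r ∈ S. If in addition θ_s > 0 for all s ∈ S, κ is irreducible with respect to θ, and χ(κ,θ) < 1, then Γ_r(θ) = ∞ for every r ∈ S. -/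
open scoped Classical ENNReal
open Filter MeasureTheory

noncomputable section

/-! ### Helper lemmas -/

lemma sum_le_sum_inj_aux {ι' κ' : Type*} (s : Finset ι') (t : Finset κ') (i : ι' → κ')
    (f : ι' → ℝ) (g : κ' → ℝ) (hi : ∀ a ∈ s, i a ∈ t)
    (hinj : ∀ a ∈ s, ∀ b ∈ s, i a = i b → a = b)
    (hfg : ∀ a ∈ s, f a ≤ g (i a)) (hg : ∀ b ∈ t, 0 ≤ g b) :
    ∑ a ∈ s, f a ≤ ∑ b ∈ t, g b := by
  classical
  calc ∑ a ∈ s, f a ≤ ∑ a ∈ s, g (i a) := Finset.sum_le_sum hfg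
    _ = ∑ b ∈ s.image i, g b := by
        rw [Finset.sum_image]
        intro a ha b hb h
        exact hinj a ha b hb h
    _ ≤ ∑ b ∈ t, g b := by
        apply Finset.sum_le_sum_of_subset_of_nonneg
        · intro b hb
          obtain ⟨a, ha, rfl⟩ := Finset.mem_image.1 hb
          exact hi a ha
        · intro b hb _
          exact hg b hb

lemma exists_closer {V : Type*} (G : SimpleGraph V) (hG : G.Connected) (r v : V) (hv : v ≠ r) :
    ∃ u, G.Adj v u ∧ G.dist u r < G.dist v r := by
  obtain ⟨p, hp⟩ := hG.exists_walk_length_eq_dist v r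
  cases p with
  | nil => exact absurd rfl hv
  | @cons _ u _ h q =>
    refine ⟨u, h, ?_⟩
    have := SimpleGraph.dist_le q
    simp at hp
    omega

/-- the ordered edge between `u` and `v` -/
def sedge {n : ℕ} (u v : Fin n) : Fin n × Fin n := (min u v, max u v)

lemma sedge_eq {n : ℕ} {u v u' v' : Fin n} (h : sedge u v = sedge u' v') :
    (u = u' ∧ v = v') ∨ (u = v' ∧ v = u') := by
  simp only [sedge, Prod.mk.injEq] at h
  obtain ⟨h1, h2⟩ := h
  rcases le_total u v with a | a <;> rcases le_total u' v' with b | b <;>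
    simp [a, b] at h1 h2 <;> simp [h1, h2]

lemma sedge_val {n : ℕ} (a : Fin n → Fin n → ℝ) (ha : ∀ u v, a u v = a v u) (u v : Fin n) :
    a (sedge u v).1 (sedge u v).2 = a u v := by
  rcases le_total u v with h | h
  · simp [sedge, h]
  · simp [sedge, h, ha v u]

lemma sedge_mem_of_adj {n : ℕ} {E : Finset (Fin n × Fin n)} (hE : E ⊆ upperPairs n)
    {u v : Fin n} (h : (graphOf E).Adj u v) : sedge u v ∈ E := by
  simp only [graphOf, SimpleGraph.fromRel_adj] at h
  rcases h with ⟨_, h | h⟩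
  · have := hE h
    simp [upperPairs] at this
    simpa [sedge, this.le] using h
  · have := hE h
    simp [upperPairs] at this
    simpa [sedge, this.le] using h

lemma adj_of_sedge_mem {n : ℕ} {E : Finset (Fin n × Fin n)}
    {u v : Fin n} (huv : u ≠ v) (h : sedge u v ∈ E) : (graphOf E).Adj u v := by
  simp only [graphOf, SimpleGraph.fromRel_adj]
  refine ⟨huv, ?_⟩
  rcases le_total u v with h' | h'
  · left; simpa [sedge, h'] using h
  · right; simpa [sedge, h'] using h

lemma tree_exists_fun {n : ℕ} (hn : 2 ≤ n) (a : Fin n → Fin n → ℝ) (ha : ∀ u v, a u v = a v u)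
    (ha0 : ∀ u v, 0 ≤ a u v) (c : ℝ) (hc : ∀ u v, 0 < a u v → c ≤ a u v)
    (E : Finset (Fin n × Fin n)) (hE : E ⊆ upperPairs n) (hconn : (graphOf E).Connected)
    (hcard : E.card + 1 = n) :
    ∃ f : Fin n → Fin n, E = Finset.univ.image (fun v => sedge v (f v)) ∧
      c * ∏ q ∈ E, a q.1 q.2 ≤ ∏ v, a v (f v) := by
  have h0 : 0 < n := by omega
  let z : Fin n := ⟨0, by omega⟩
  let o : Fin n := ⟨1, by omega⟩
  have hoz : z ≠ o := by simp [z, o]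
  have H : ∀ v, ∃ u, (graphOf E).Adj v u ∧
      (v ≠ z → (graphOf E).dist u z < (graphOf E).dist v z) := by
    intro v
    by_cases hv : v = z
    · obtain ⟨u, hu, _⟩ := exists_closer _ hconn o z hoz
      exact ⟨u, hv ▸ hu, fun h => absurd hv h⟩
    · obtain ⟨u, hu, h⟩ := exists_closer _ hconn z v hv
      exact ⟨u, hu, fun _ => h⟩
  choose f hf hd using H
  have hmem : ∀ v, sedge v (f v) ∈ E := fun v => sedge_mem_of_adj hE (hf v)
  have hinj : ∀ u ∈ Finset.univ.erase z, ∀ v ∈ Finset.univ.erase z,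
      sedge u (f u) = sedge v (f v) → u = v := by
    intro u hu v hv h
    rcases sedge_eq h with h | h
    · exact h.1
    · have h1 := hd u (Finset.ne_of_mem_erase hu)
      have h2 := hd v (Finset.ne_of_mem_erase hv)
      rw [h.2] at h1
      rw [← h.1] at h2
      omega
  have hEq : (Finset.univ.erase z).image (fun v => sedge v (f v)) = E := by
    apply Finset.eq_of_subset_of_card_le
    · intro q hq
      obtain ⟨v, _, rfl⟩ := Finset.mem_image.1 hq
      exact hmem v
    · rw [Finset.card_image_of_injOn (fun u hu v hv h => hinj u hu v hv h),
        Finset.card_erase_of_mem (Finset.mem_univ _)]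
      simp; omega
  refine ⟨f, ?_, ?_⟩
  · apply Finset.Subset.antisymm
    · nth_rewrite 1 [← hEq]
      exact Finset.image_subset_image (Finset.erase_subset _ _)
    · intro q hq
      obtain ⟨v, _, rfl⟩ := Finset.mem_image.1 hq
      exact hmem v
  · have hprod : ∏ q ∈ E, a q.1 q.2 = ∏ v ∈ Finset.univ.erase z, a v (f v) := by
      conv_lhs => rw [← hEq]
      rw [Finset.prod_image (fun u hu v hv h => hinj u hu v hv h)]
      exact Finset.prod_congr rfl fun v _ => sedge_val a ha v (f v)
    rw [← Finset.mul_prod_erase _ _ (Finset.mem_univ z), ← hprod]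
    have hP : 0 ≤ ∏ q ∈ E, a q.1 q.2 := Finset.prod_nonneg fun q _ => ha0 _ _
    rcases hP.eq_or_lt with h | h
    · rw [← h]; simp
    · apply mul_le_mul_of_nonneg_right _ hP
      apply hc
      have := (Finset.prod_ne_zero_iff.1 h.ne') _ (hmem z)
      rw [sedge_val a ha] at this
      exact lt_of_le_of_ne (ha0 _ _) this.symm

lemma treeWeight_upper {S : Type*} {n : ℕ} (hn : 2 ≤ n) (x : Fin n → S) (κ : S → S → ℝ)
    (hs : ∀ r s, κ r s = κ s r) (h0 : ∀ r s, 0 ≤ κ r s) (c : ℝ)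
    (hc : ∀ r s, 0 < κ r s → c ≤ κ r s) :
    c * treeWeight n x κ ≤ ∏ v, ∑ u, κ (x v) (x u) := by
  have H : ∀ E : Finset (Fin n × Fin n), ∃ f : Fin n → Fin n,
      (E ∈ (upperPairs n).powerset.filter
        (fun E => (graphOf E).Connected ∧ E.card + 1 = n)) →
      E = Finset.univ.image (fun v => sedge v (f v)) ∧
      c * ∏ q ∈ E, κ (x q.1) (x q.2) ≤ ∏ v, κ (x v) (x (f v)) := by
    intro E
    by_cases hE : (E ∈ (upperPairs n).powerset.filter
        (fun E => (graphOf E).Connected ∧ E.card + 1 = n))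
    · have hE' := hE
      simp only [Finset.mem_filter, Finset.mem_powerset] at hE'
      obtain ⟨f, hf⟩ := tree_exists_fun hn (fun u v => κ (x u) (x v)) (fun _ _ => hs _ _)
        (fun _ _ => h0 _ _) c (fun _ _ => hc _ _) E hE'.1 hE'.2.1 hE'.2.2
      exact ⟨f, fun _ => hf⟩
    · exact ⟨id, fun h => absurd h hE⟩
  choose F hF using H
  have e : ∏ v, ∑ u, κ (x v) (x u) = ∑ f : Fin n → Fin n, ∏ v, κ (x v) (x (f v)) := by
    rw [Finset.prod_univ_sum]
    simp
  rw [e, treeWeight, Finset.mul_sum]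
  apply sum_le_sum_inj_aux _ _ F
  · intro _ _; exact Finset.mem_univ _
  · intro A hA B hB h
    rw [(hF A hA).1, (hF B hB).1, h]
  · intro A hA
    exact (hF A hA).2
  · intro f _
    exact Finset.prod_nonneg fun _ _ => h0 _ _

/-- acyclic parent maps of `R` into `L ∪ R`. -/
def forests {V : Type*} [Fintype V] (L R : Finset V) : Finset (V → V) :=
  Finset.univ.filter fun f => (∀ v, v ∉ R → f v = v) ∧ (∀ v ∈ R, f v ∈ L ∨ f v ∈ R) ∧
    ∃ d : V → ℕ, ∀ v ∈ R, d (f v) < d v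

/-- total weight of the forests -/
def fweight {V : Type*} [Fintype V] (a : V → V → ℝ) (L R : Finset V) : ℝ :=
  ∑ f ∈ forests L R, ∏ v ∈ R, a v (f v)

lemma fweight_nonneg {V : Type*} [Fintype V] (a : V → V → ℝ) (ha : ∀ u v, 0 ≤ a u v)
    (L R : Finset V) : 0 ≤ fweight a L R :=
  Finset.sum_nonneg fun _ _ => Finset.prod_nonneg fun _ _ => ha _ _

lemma fweight_empty {V : Type*} [Fintype V] (a : V → V → ℝ) (L : Finset V) :
    fweight a L ∅ = 1 := by
  have : forests L (∅ : Finset V) = {id} := by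
    ext f
    simp [forests, funext_iff]
  simp [fweight, this]

lemma fweight_le_treeWeight {S : Type*} {n : ℕ} (x : Fin n → S) (κ : S → S → ℝ)
    (hs : ∀ r s, κ r s = κ s r) (h0 : ∀ r s, 0 ≤ κ r s) (z : Fin n) :
    fweight (fun u v => κ (x u) (x v)) {z} (Finset.univ.erase z) ≤ treeWeight n x κ := by
  have hn : 0 < n := z.pos
  unfold fweight treeWeight
  have key : ∀ f ∈ forests {z} (Finset.univ.erase z), f z = z ∧
      ∃ d : Fin n → ℕ, ∀ v, v ≠ z → d (f v) < d v := by
    intro f hf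
    simp only [forests, Finset.mem_filter] at hf
    obtain ⟨_, h1, _, d, hd⟩ := hf
    exact ⟨h1 z (by simp), d, fun v hv => hd v (by simp [hv])⟩
  have hinj : ∀ f ∈ forests {z} (Finset.univ.erase z),
      ∀ u ∈ Finset.univ.erase z, ∀ v ∈ Finset.univ.erase z,
      sedge u (f u) = sedge v (f v) → u = v := by
    intro f hf u hu v hv h
    obtain ⟨_, d, hd⟩ := key f hf
    rcases sedge_eq h with h | h
    · exact h.1
    · have h1 := hd u (Finset.ne_of_mem_erase hu)
      have h2 := hd v (Finset.ne_of_mem_erase hv)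
      rw [h.2] at h1
      rw [← h.1] at h2
      omega
  apply sum_le_sum_inj_aux _ _
    (fun f : Fin n → Fin n => (Finset.univ.erase z).image (fun v => sedge v (f v)))
  · intro f hf
    obtain ⟨hz, d, hd⟩ := key f hf
    have hne : ∀ v, v ≠ z → v ≠ f v := by
      intro v hv h
      have := hd v hv
      rw [← h] at this
      omega
    simp only [Finset.mem_filter, Finset.mem_powerset]
    refine ⟨?_, ?_, ?_⟩
    · intro q hq
      obtain ⟨v, hv, rfl⟩ := Finset.mem_image.1 hq
      simp [upperPairs, sedge, (hne v (Finset.ne_of_mem_erase hv)).symm]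
    · have hr : ∀ N : ℕ, ∀ v, d v < N → (graphOf ((Finset.univ.erase z).image
          (fun v => sedge v (f v)))).Reachable v z := by
        intro N
        induction N with
        | zero => intro v h; omega
        | succ N ih =>
          intro v h
          by_cases hv : v = z
          · subst hv; exact SimpleGraph.Reachable.refl _
          · have := hd v hv
            refine SimpleGraph.Reachable.trans (SimpleGraph.Adj.reachable ?_) (ih (f v) (by omega))
            apply adj_of_sedge_mem (hne v hv)
            exact Finset.mem_image.2 ⟨v, by simp [hv], rfl⟩
      have : Nonempty (Fin n) := ⟨z⟩
      refine ⟨fun u v => ?_⟩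
      exact (hr _ u (Nat.lt_succ_self _)).trans (hr _ v (Nat.lt_succ_self _)).symm
    · rw [Finset.card_image_of_injOn (fun u hu v hv h => hinj f hf u hu v hv h),
        Finset.card_erase_of_mem (Finset.mem_univ _)]
      simp; omega
  · intro f hf g hg h
    obtain ⟨hfz, d, hd⟩ := key f hf
    obtain ⟨hgz, d', hd'⟩ := key g hg
    have : ∀ N : ℕ, ∀ v, d v < N → f v = g v := by
      intro N
      induction N with
      | zero => intro v h; omega
      | succ N ih =>
        intro v hN
        by_cases hv : v = z
        · rw [hv, hfz, hgz]
        · have hdv := hd v hv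
          have hm : sedge v (f v) ∈ (Finset.univ.erase z).image (fun v => sedge v (g v)) := by
            rw [← h]
            exact Finset.mem_image.2 ⟨v, by simp [hv], rfl⟩
          obtain ⟨u, hu, he⟩ := Finset.mem_image.1 hm
          rcases sedge_eq he with ⟨h1, h2⟩ | ⟨h1, h2⟩
          · rw [← h1, h2, h1]
          · exfalso
            have h3 := ih (f v) (by omega)
            have hu' := Finset.ne_of_mem_erase hu
            have h4 := hd u hu'
            rw [h1, h3, ← h1, h2] at h4
            rw [h1] at h4
            omega
    funext v
    exact this _ v (Nat.lt_succ_self _)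
  · intro f hf
    rw [Finset.prod_image (hinj f hf)]
    apply le_of_eq
    exact Finset.prod_congr rfl fun v _ =>
      (sedge_val (fun u v => κ (x u) (x v)) (fun _ _ => hs _ _) v (f v)).symm
  · intro E _
    exact Finset.prod_nonneg fun _ _ => h0 _ _

lemma prod_sum_pi_aux {V : Type*} [Fintype V] [DecidableEq V] (a : V → V → ℝ) (L M : Finset V) :
    ∏ v ∈ M, ∑ u ∈ L, a v u =
      ∑ g ∈ Fintype.piFinset (fun v => if v ∈ M then L else {v}), ∏ v ∈ M, a v (g v) := by
  have h1 : ∏ v ∈ M, ∑ u ∈ L, a v u =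
      ∏ v, ∑ u ∈ (if v ∈ M then L else {v}), (if v ∈ M then a v u else 1) := by
    rw [← Finset.prod_subset (Finset.subset_univ M)]
    · exact Finset.prod_congr rfl fun v hv => by simp [hv]
    · intro v _ hv
      simp [hv]
  rw [h1, Finset.prod_univ_sum]
  refine Finset.sum_congr rfl fun g _ => ?_
  rw [← Finset.prod_subset (Finset.subset_univ M)]
  · exact Finset.prod_congr rfl fun v hv => by simp [hv]
  · intro v _ hv
    simp [hv]

lemma prod_ite_split {V : Type*} [DecidableEq V] (a : V → V → ℝ) {M R : Finset V} (hM : M ⊆ R) (g f : V → V) :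
    ∏ v ∈ R, a v (if v ∈ M then g v else f v) =
      (∏ v ∈ M, a v (g v)) * ∏ v ∈ R \ M, a v (f v) := by
  rw [← Finset.prod_sdiff hM, mul_comm]
  congr 1
  · exact Finset.prod_congr rfl fun v hv => by simp [hv]
  · exact Finset.prod_congr rfl fun v hv => by simp [(Finset.mem_sdiff.1 hv).2]

lemma fweight_layer {V : Type*} [Fintype V] [DecidableEq V] (a : V → V → ℝ) (ha : ∀ u v, 0 ≤ a u v)
    (L R : Finset V) (hLR : Disjoint L R) (𝓜 : Finset (Finset V)) (h𝓜 : ∀ M ∈ 𝓜, M ⊆ R) :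
    ∑ M ∈ 𝓜, (∏ v ∈ M, ∑ u ∈ L, a v u) * fweight a M (R \ M) ≤ fweight a L R := by
  have e : ∀ M ∈ 𝓜, (∏ v ∈ M, ∑ u ∈ L, a v u) * fweight a M (R \ M) =
      ∑ p ∈ (Fintype.piFinset (fun v => if v ∈ M then L else {v})) ×ˢ forests M (R \ M),
        (∏ v ∈ M, a v (p.1 v)) * ∏ v ∈ R \ M, a v (p.2 v) := by
    intro M _
    rw [prod_sum_pi_aux, fweight, Finset.sum_mul_sum, Finset.sum_product]
  rw [Finset.sum_congr rfl e, Finset.sum_sigma']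
  have hLR' : ∀ v, v ∈ L → v ∉ R := fun v h1 h2 => (Finset.disjoint_left.1 hLR) h1 h2
  have key : ∀ p : (Σ _ : Finset V, (V → V) × (V → V)),
      p ∈ 𝓜.sigma (fun M => (Fintype.piFinset (fun v => if v ∈ M then L else {v})) ×ˢ
        forests M (R \ M)) → p.1 ⊆ R ∧ (∀ v ∈ p.1, p.2.1 v ∈ L) ∧ (∀ v, v ∉ p.1 → p.2.1 v = v) ∧
        (∀ v, (v ∈ R → v ∈ p.1) → p.2.2 v = v) ∧
        (∀ v ∈ R, v ∉ p.1 → p.2.2 v ∈ R) ∧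
        ∃ d : V → ℕ, ∀ v ∈ R, v ∉ p.1 → d (p.2.2 v) < d v := by
    rintro ⟨M, g, f⟩ hp
    simp only [Finset.mem_sigma, Finset.mem_product, Fintype.mem_piFinset, forests,
      Finset.mem_filter, Finset.mem_sdiff, Finset.mem_univ, true_and] at hp
    obtain ⟨hM, hg, h1, h2, d, hd⟩ := hp
    have hMR := h𝓜 M hM
    refine ⟨hMR, ?_, ?_, ?_, ?_, d, ?_⟩
    · intro v hv
      have := hg v
      have hv' : v ∈ M := hv
      rwa [if_pos hv'] at this
    · intro v hv
      have := hg v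
      have hv' : v ∉ M := hv
      rw [if_neg hv'] at this
      simpa using this
    · intro v hv
      exact h1 v (by simpa using hv)
    · intro v hv hv'
      rcases h2 v ⟨hv, hv'⟩ with h | h
      · exact hMR h
      · exact h.1
    · intro v hv hv'
      exact hd v ⟨hv, hv'⟩
  unfold fweight
  apply sum_le_sum_inj_aux _ _
    (fun p : (Σ _ : Finset V, (V → V) × (V → V)) => fun v => if v ∈ p.1 then p.2.1 v else p.2.2 v)
  · intro p hp
    obtain ⟨h1, h2, h3, h4, h5, d, hd⟩ := key p hp
    simp only [forests, Finset.mem_filter, Finset.mem_univ, true_and]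
    refine ⟨?_, ?_, fun v => if v ∈ L then 0 else d v + 1, ?_⟩
    · intro v hv
      have : v ∉ p.1 := fun h => hv (h1 h)
      rw [if_neg this]
      exact h4 v (fun h => absurd h hv)
    · intro v hv
      by_cases hvM : v ∈ p.1
      · left; rw [if_pos hvM]; exact h2 v hvM
      · right; rw [if_neg hvM]; exact h5 v hv hvM
    · intro v hv
      have hvL : v ∉ L := fun h => hLR' v h hv
      by_cases hvM : v ∈ p.1
      · simp [hvM, h2 v hvM, hvL]
      · have h6 : p.2.2 v ∉ L := fun h => hLR' _ h (h5 v hv hvM)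
        simp [hvM, h6, hvL, hd v hv hvM]
  · intro p hp q hq h
    have hM : ∀ p : (Σ _ : Finset V, (V → V) × (V → V)),
      p ∈ 𝓜.sigma (fun M => (Fintype.piFinset (fun v => if v ∈ M then L else {v})) ×ˢ
        forests M (R \ M)) → p.1 = R.filter (fun v =>
          (if v ∈ p.1 then p.2.1 v else p.2.2 v) ∈ L) := by
      intro p hp
      obtain ⟨h1, h2, h3, h4, h5, d, hd⟩ := key p hp
      ext v
      simp only [Finset.mem_filter]
      constructor
      · intro hv
        exact ⟨h1 hv, by rw [if_pos hv]; exact h2 v hv⟩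
      · rintro ⟨hv, hv'⟩
        by_contra hvM
        rw [if_neg hvM] at hv'
        exact hLR' _ hv' (h5 v hv hvM)
    have hpq : p.1 = q.1 := by
      rw [hM p hp, hM q hq]
      apply Finset.filter_congr
      intro v _
      have := congrFun h v
      beta_reduce at this
      rw [this]
    obtain ⟨M, g, f⟩ := p
    obtain ⟨M', g', f'⟩ := q
    simp only at hpq
    subst hpq
    obtain ⟨h1, h2, h3, h4, h5, -⟩ := key _ hp
    obtain ⟨h1', h2', h3', h4', h5', -⟩ := key _ hq
    simp only at h1 h2 h3 h4 h5 h1' h2' h3' h4' h5'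
    have hg : g = g' := by
      funext v
      by_cases hv : v ∈ M
      · have := congrFun h v
        simpa [hv] using this
      · rw [h3 v hv, h3' v hv]
    have hf : f = f' := by
      funext v
      by_cases hv : v ∈ M
      · rw [h4 v (fun _ => hv), h4' v (fun _ => hv)]
      · have := congrFun h v
        simpa [hv] using this
    rw [hg, hf]
  · intro p hp
    rw [prod_ite_split a (key p hp).1]
  · intro f _
    exact Finset.prod_nonneg fun _ _ => ha _ _

lemma fweight_glue {V : Type*} [Fintype V] [DecidableEq V] (a : V → V → ℝ) (ha : ∀ u v, 0 ≤ a u v)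
    (L M R U : Finset V) (hM : M ⊆ R) (hLR : Disjoint L R) (hU : ∀ v, v ∈ U ↔ v ∈ L ∨ v ∈ M) :
    ∀ f ∈ forests L M, (∏ v ∈ M, a v (f v)) * fweight a U (R \ M) ≤ fweight a L R := by
  intro f hf
  unfold fweight
  rw [Finset.mul_sum]
  simp only [forests, Finset.mem_filter, Finset.mem_univ, true_and] at hf
  obtain ⟨h1, h2, d, hd⟩ := hf
  apply sum_le_sum_inj_aux _ _ (fun g : V → V => fun v => if v ∈ M then f v else g v)
  · intro g hg
    simp only [forests, Finset.mem_filter, Finset.mem_univ, true_and, Finset.mem_sdiff] at hg ⊢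
    obtain ⟨g1, g2, d', hd'⟩ := hg
    refine ⟨?_, ?_, fun v => if v ∈ M ∨ v ∉ R then d v else d' v + 1 + ∑ u, d u, ?_⟩
    · intro v hv
      have : v ∉ M := fun h => hv (hM h)
      rw [if_neg this]
      exact g1 v (fun h => hv h.1)
    · intro v hv
      by_cases hvM : v ∈ M
      · rw [if_pos hvM]
        rcases h2 v hvM with h | h
        · exact Or.inl h
        · exact Or.inr (hM h)
      · rw [if_neg hvM]
        rcases g2 v ⟨hv, hvM⟩ with h | h
        · rcases (hU _).1 h with h | h
          · exact Or.inl h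
          · exact Or.inr (hM h)
        · exact Or.inr h.1
    · intro v hv
      have hLR' : ∀ v, v ∈ L → v ∉ R := fun v h1 h2 => (Finset.disjoint_left.1 hLR) h1 h2
      by_cases hvM : v ∈ M
      · have h3 : f v ∈ M ∨ f v ∉ R := by
          rcases h2 v hvM with h | h
          · exact Or.inr (hLR' _ h)
          · exact Or.inl h
        simp only [if_pos hvM, if_pos h3, if_pos (Or.inl hvM : v ∈ M ∨ v ∉ R)]
        exact hd v hvM
      · have h3 : ¬ (v ∈ M ∨ v ∉ R) := by tauto
        simp only [if_neg hvM, if_neg h3]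
        have h5 := Finset.single_le_sum (f := d) (fun _ _ => Nat.zero_le _)
          (Finset.mem_univ (g v))
        split_ifs with h4
        · omega
        · have := hd' v ⟨hv, hvM⟩
          omega
  · intro g hg g' hg' h
    simp only [forests, Finset.mem_filter, Finset.mem_univ, true_and, Finset.mem_sdiff] at hg hg'
    funext v
    by_cases hv : v ∈ M
    · rw [hg.1 v (fun h => h.2 hv), hg'.1 v (fun h => h.2 hv)]
    · have := congrFun h v
      simpa [hv] using this
  · intro g hg
    rw [prod_ite_split a hM]
  · intro g _
    exact Finset.prod_nonneg fun _ _ => ha _ _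

/-- type population of a set of vertices -/
def pop {V S : Type*} (x : V → S) (M : Finset V) (s : S) : ℕ := (M.filter (fun v => x v = s)).card

lemma pop_prod {V S : Type*} [Fintype S] (x : V → S) (M : Finset V) (φ : S → ℝ) :
    ∏ v ∈ M, φ (x v) = ∏ s, φ s ^ pop x M s := by
  rw [← Finset.prod_fiberwise M x]
  refine Finset.prod_congr rfl fun s _ => ?_
  rw [pop, ← Finset.prod_const]
  exact Finset.prod_congr rfl fun v hv => by rw [(Finset.mem_filter.1 hv).2]

lemma pop_sum {V S : Type*} [Fintype S] (x : V → S) (M : Finset V) (φ : S → ℝ) :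
    ∑ v ∈ M, φ (x v) = ∑ s, φ s * pop x M s := by
  rw [← Finset.sum_fiberwise M x]
  refine Finset.sum_congr rfl fun s _ => ?_
  rw [pop, mul_comm, ← nsmul_eq_mul, ← Finset.sum_const]
  exact Finset.sum_congr rfl fun v hv => by rw [(Finset.mem_filter.1 hv).2]

lemma pop_sdiff {V S : Type*} [DecidableEq V] (x : V → S) {M R : Finset V} (h : M ⊆ R) (s : S) :
    pop x (R \ M) s + pop x M s = pop x R s := by
  unfold pop
  rw [← Finset.card_union_of_disjoint]
  · congr 1
    ext v
    simp only [Finset.mem_union, Finset.mem_filter, Finset.mem_sdiff]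
    have := @h v
    tauto
  · rw [Finset.disjoint_left]
    intro v
    simp only [Finset.mem_filter, Finset.mem_sdiff]
    tauto

lemma pop_compatVec {S : Type*} [Fintype S] (k : S → ℕ) (s : S) :
    pop (compatVec k) Finset.univ s = k s := by
  have h1 : (Finset.univ : Finset (Fin (∑ s, k s))).val.map (compatVec k) =
      ∑ s : S, (k s) • ({s} : Multiset S) := by
    rw [← Multiset.coe_toList (∑ s : S, (k s) • ({s} : Multiset S))]
    change _ = ((compatList k : List S) : Multiset S)
    rw [Fin.univ_val_map]
    congr 1
    apply List.ext_get
    · simp [compatList_length]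
    · intro i h1 h2
      simp [compatVec]
  have h2 : pop (compatVec k) Finset.univ s =
      Multiset.count s ((Finset.univ : Finset (Fin (∑ s, k s))).val.map (compatVec k)) := by
    rw [Multiset.count_map, pop, Finset.card_def, Finset.filter_val]
    congr 1
    apply Multiset.filter_congr
    intro v _
    exact eq_comm
  rw [h2, h1, Multiset.count_sum']
  simp [Multiset.count_singleton]

lemma card_layers {V S : Type*} [Fintype S] (x : V → S) (R : Finset V) (m : S → ℕ) :
    ∏ s, (pop x R s).choose (m s) ≤ (R.powerset.filter (fun M => pop x M = m)).card := by
  have : ∏ s, (pop x R s).choose (m s) = (Fintype.piFinset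
      (fun s => (R.filter (fun v => x v = s)).powersetCard (m s))).card := by
    rw [Fintype.card_piFinset]
    exact Finset.prod_congr rfl fun s _ => by rw [Finset.card_powersetCard, pop]
  rw [this]
  have hfil : ∀ t ∈ Fintype.piFinset
      (fun s => (R.filter (fun v => x v = s)).powersetCard (m s)), ∀ s,
      (Finset.univ.biUnion t).filter (fun v => x v = s) = t s := by
    intro t ht s
    rw [Fintype.mem_piFinset] at ht
    ext v
    simp only [Finset.mem_filter, Finset.mem_biUnion, Finset.mem_univ, true_and]
    have h1 : ∀ s, v ∈ t s → x v = s := fun s hv => by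
      have := (Finset.mem_powersetCard.1 (ht s)).1 hv
      exact (Finset.mem_filter.1 this).2
    constructor
    · rintro ⟨⟨s', hs'⟩, h⟩
      have := h1 s' hs'
      rw [← h, this]; exact hs'
    · intro hv
      exact ⟨⟨s, hv⟩, h1 s hv⟩
  apply Finset.card_le_card_of_injOn (fun t => Finset.univ.biUnion t)
  · intro t ht
    have hf := hfil t ht
    have ht' := Fintype.mem_piFinset.1 (Finset.mem_coe.1 ht)
    simp only [Finset.coe_filter, Set.mem_ofPred_eq, Finset.mem_powerset]
    constructor
    · intro v hv
      obtain ⟨s, _, hs⟩ := Finset.mem_biUnion.1 hv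
      exact (Finset.mem_filter.1 ((Finset.mem_powersetCard.1 (ht' s)).1 hs)).1
    · funext s
      rw [pop, hf s]
      exact (Finset.mem_powersetCard.1 (ht' s)).2
  · intro t ht t' ht' h
    funext s
    rw [← hfil t ht s, ← hfil t' ht' s]
    simp only at h
    rw [h]

lemma exists_layer {V S : Type*} [Fintype S] (x : V → S) (R : Finset V) (m : S → ℕ)
    (h : ∀ s, m s ≤ pop x R s) : ∃ M ⊆ R, pop x M = m := by
  have h1 := card_layers x R m
  have h2 : 0 < ∏ s, (pop x R s).choose (m s) :=
    Finset.prod_pos fun s _ => Nat.choose_pos (h s)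
  obtain ⟨M, hM⟩ := Finset.card_pos.1 (h2.trans_le h1)
  simp only [Finset.mem_filter, Finset.mem_powerset] at hM
  exact ⟨M, hM⟩

lemma layered_bound {V S : Type*} [Fintype V] [DecidableEq V] [Fintype S] (x : V → S) (κ : S → S → ℝ)
    (h0 : ∀ r s, 0 ≤ κ r s) (m : S → ℕ) (h : ℕ) : ∀ (L R : Finset V), Disjoint L R →
    pop x L = m → (∀ s, pop x R s = h * m s) →
    (∏ s, ((h * m s).factorial : ℝ)) * (∏ s, (∑ t, κ s t * m t) ^ m s) ^ h ≤
      fweight (fun u v => κ (x u) (x v)) L R * (∏ s, ((m s).factorial : ℝ)) ^ h := by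
  induction h with
  | zero =>
    intro L R hd hL hR
    have : R = ∅ := by
      rw [Finset.eq_empty_iff_forall_notMem]
      intro v hv
      have := hR (x v)
      simp only [pop, zero_mul, Finset.card_eq_zero] at this
      have h2 : v ∈ R.filter (fun u => x u = x v) := by simp [hv]
      rw [this] at h2
      simp at h2
    simp [this, fweight_empty]
  | succ h ih =>
    intro L R hd hL hR
    set a : V → V → ℝ := fun u v => κ (x u) (x v) with ha
    have ha0 : ∀ u v, 0 ≤ a u v := fun _ _ => h0 _ _
    set P : ℝ := ∏ s, (∑ t, κ s t * m t) ^ m s with hP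
    set F : ℝ := ∏ s, ((m s).factorial : ℝ) with hF
    set 𝓜 := R.powerset.filter (fun M => pop x M = m) with h𝓜
    have hP0 : 0 ≤ P := Finset.prod_nonneg fun s _ =>
      pow_nonneg (Finset.sum_nonneg fun t _ => mul_nonneg (h0 _ _) (Nat.cast_nonneg _)) _
    have hF0 : 0 < F := Finset.prod_pos fun s _ => by exact_mod_cast Nat.factorial_pos _
    have h1 := fweight_layer a ha0 L R hd 𝓜 (fun M hM => by
      simp only [h𝓜, Finset.mem_filter, Finset.mem_powerset] at hM
      exact hM.1)
    set H : ℝ := ∏ s, ((h * m s).factorial : ℝ) with hH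
    have h2 : ∀ M ∈ 𝓜, P * (H * P ^ h / F ^ h) ≤
        (∏ v ∈ M, ∑ u ∈ L, a v u) * fweight a M (R \ M) := by
      intro M hM
      simp only [h𝓜, Finset.mem_filter, Finset.mem_powerset] at hM
      have e1 : ∏ v ∈ M, ∑ u ∈ L, a v u = P := by
        have : ∀ v, ∑ u ∈ L, a v u = ∑ t, κ (x v) t * m t := by
          intro v
          rw [← hL]
          exact pop_sum x L (fun t => κ (x v) t)
        simp_rw [this]
        rw [pop_prod x M (fun s => ∑ t, κ s t * m t), hM.2]
      rw [e1]
      apply mul_le_mul_of_nonneg_left _ hP0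
      rw [div_le_iff₀ (pow_pos hF0 h)]
      apply ih M (R \ M) Finset.disjoint_sdiff hM.2
      intro s
      have := pop_sdiff x hM.1 s
      rw [hM.2, hR s] at this
      rw [add_mul] at this
      omega
    have h3 := (Finset.card_nsmul_le_sum 𝓜 _ _ h2).trans h1
    have h4 := card_layers x R m
    have h5 : (∏ s, (((h + 1) * m s).choose (m s) : ℝ)) ≤ (𝓜.card : ℝ) := by
      have : ∏ s, ((h + 1) * m s).choose (m s) ≤ 𝓜.card := by
        simp_rw [hR] at h4
        exact h4
      exact_mod_cast this
    have h6 : (∏ s, (((h + 1) * m s).factorial : ℝ)) =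
        (∏ s, (((h + 1) * m s).choose (m s) : ℝ)) * F * H := by
      rw [hF, hH, ← Finset.prod_mul_distrib, ← Finset.prod_mul_distrib]
      refine Finset.prod_congr rfl fun s _ => ?_
      have h7 : m s ≤ (h + 1) * m s := Nat.le_mul_of_pos_left _ (Nat.succ_pos _)
      have h8 := Nat.choose_mul_factorial_mul_factorial h7
      have h9 : (h + 1) * m s - m s = h * m s := by rw [add_mul]; omega
      rw [h9] at h8
      exact_mod_cast h8.symm
    have hH0 : 0 < H := Finset.prod_pos fun s _ => by exact_mod_cast Nat.factorial_pos _
    rw [h6]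
    rw [nsmul_eq_mul] at h3
    calc (∏ s, (((h + 1) * m s).choose (m s) : ℝ)) * F * H * P ^ (h + 1)
        ≤ (𝓜.card : ℝ) * F * H * P ^ (h + 1) := by gcongr
      _ = (𝓜.card : ℝ) * (P * (H * P ^ h / F ^ h)) * F ^ (h + 1) := by
          field_simp
          ring
      _ ≤ fweight a L R * F ^ (h + 1) := by gcongr

lemma exists_base {S : Type*} [Fintype S] [Nonempty S] (κ : S → S → ℝ)
    (hs : ∀ r s, κ r s = κ s r) (h0 : ∀ r s, 0 ≤ κ r s) (θ : S → ℝ) (hθ : ∀ s, 0 < θ s)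
    (hirr : Irred κ θ) : ∃ (r : S) (p : S → S) (d : S → ℕ), ∀ s, s ≠ r →
      0 < κ s (p s) ∧ d (p s) < d s := by
  let G : SimpleGraph S := SimpleGraph.fromRel fun r s => 0 < κ r s
  let r : S := Classical.arbitrary S
  have hG : G.Connected := by
    have : ∀ s, G.Reachable r s := by
      rcases hirr {s | G.Reachable r s} (by
        intro a ha b hb _ _
        by_contra hne
        apply hb
        have hpos : 0 < κ a b := lt_of_le_of_ne (h0 _ _) (Ne.symm hne)
        have ha' : G.Reachable r a := ha
        by_cases hab : a = b
        · rw [← hab]; exact ha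
        · exact ha'.trans (SimpleGraph.Adj.reachable
            (by simp only [G, SimpleGraph.fromRel_adj]; exact ⟨hab, Or.inl hpos⟩))) with h | h
      · exact absurd (h r (SimpleGraph.Reachable.refl r)) (hθ r).ne'
      · intro s
        by_contra hc
        exact (hθ s).ne' (h s hc)
    exact ⟨fun u v => (this u).symm.trans (this v)⟩
  have H : ∀ s, ∃ u, s ≠ r → (0 < κ s u ∧ G.dist u r < G.dist s r) := by
    intro s
    by_cases h : s = r
    · exact ⟨r, fun h' => absurd h h'⟩
    · obtain ⟨u, hu, hd⟩ := exists_closer G hG r s h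
      refine ⟨u, fun _ => ⟨?_, hd⟩⟩
      simp only [G, SimpleGraph.fromRel_adj] at hu
      rcases hu.2 with h | h
      · exact h
      · rw [hs]; exact h
  choose p hp using H
  exact ⟨r, p, fun s => G.dist s r, hp⟩

lemma tau_lower {S : Type*} [Fintype S] [Nonempty S] (κ : S → S → ℝ)
    (hs : ∀ r s, κ r s = κ s r) (h0 : ∀ r s, 0 ≤ κ r s) (θ : S → ℝ) (hθ : ∀ s, 0 < θ s)
    (hirr : Irred κ θ) (m : S → ℕ) (hm : ∀ s, 0 < m s → 0 < ∑ t, κ s t) :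
    ∃ C : ℝ, 0 < C ∧ ∀ h : ℕ,
      C * ((∏ s, ((h * m s).factorial : ℝ)) * (∏ s, (∑ t, κ s t * m t) ^ m s) ^ h) ≤
      tau κ (fun s => 1 + m s + h * m s) * (∏ s, ((m s).factorial : ℝ)) ^ h := by
  obtain ⟨r, p, d, hp⟩ := exists_base κ hs h0 θ hθ hirr
  refine ⟨(∏ s ∈ Finset.univ.erase r, κ s (p s)) * ∏ s, (∑ t, κ s t) ^ m s, ?_, ?_⟩
  · apply mul_pos
    · exact Finset.prod_pos fun s hs' => (hp s (Finset.ne_of_mem_erase hs')).1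
    · apply Finset.prod_pos
      intro s _
      rcases Nat.eq_zero_or_pos (m s) with h | h
      · simp [h]
      · exact pow_pos (hm s h) _
  · intro h
    set k : S → ℕ := fun s => 1 + m s + h * m s with hk
    set x := compatVec k with hx
    set a : Fin (∑ s, k s) → Fin (∑ s, k s) → ℝ := fun u v => κ (x u) (x v) with ha
    have ha0 : ∀ u v, 0 ≤ a u v := fun _ _ => h0 _ _
    have hpop : ∀ s, pop x Finset.univ s = k s := fun s => pop_compatVec k s
    obtain ⟨U, -, hU⟩ := exists_layer x Finset.univ (fun _ => 1) (fun s => by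
      rw [hpop]; show 1 ≤ 1 + m s + h * m s; omega)
    have hU' : ∀ s, ∃ v, U.filter (fun v => x v = s) = {v} := by
      intro s
      exact Finset.card_eq_one.1 (congrFun hU s)
    choose σ hσ using hU'
    have hσ1 : ∀ v s, (v ∈ U ∧ x v = s) ↔ v = σ s := by
      intro v s
      have : v ∈ U.filter (fun v => x v = s) ↔ v ∈ ({σ s} : Finset _) := by rw [hσ s]
      rwa [Finset.mem_filter, Finset.mem_singleton] at this
    have hσU : ∀ s, σ s ∈ U := fun s => ((hσ1 (σ s) s).2 rfl).1
    have hσx : ∀ s, x (σ s) = s := fun s => ((hσ1 (σ s) s).2 rfl).2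
    set z := σ r with hz
    have popU : ∀ s, pop x (Finset.univ \ U) s = m s + h * m s := by
      intro s
      have := pop_sdiff x (Finset.subset_univ U) s
      rw [hU, hpop] at this
      have hks : k s = 1 + m s + h * m s := rfl
      simp only at this
      omega
    obtain ⟨M, hMU, hM⟩ := exists_layer x (Finset.univ \ U) m (fun s => by rw [popU]; omega)
    have popR : ∀ s, pop x ((Finset.univ \ U) \ M) s = h * m s := by
      intro s
      have := pop_sdiff x hMU s
      rw [hM, popU] at this
      omega
    have b1 := layered_bound x κ h0 m h M ((Finset.univ \ U) \ M) Finset.disjoint_sdiff hM popR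
    have b2 := fweight_layer a ha0 U (Finset.univ \ U) Finset.disjoint_sdiff {M} (by simpa using hMU)
    rw [Finset.sum_singleton] at b2
    have e2 : ∏ v ∈ M, ∑ u ∈ U, a v u = ∏ s, (∑ t, κ s t) ^ m s := by
      have : ∀ v, ∑ u ∈ U, a v u = ∑ t, κ (x v) t := by
        intro v
        have := pop_sum x U (fun t => κ (x v) t)
        rw [hU] at this
        simpa using this
      simp_rw [this]
      rw [pop_prod x M (fun s => ∑ t, κ s t), hM]
    rw [e2] at b2
    let f : Fin (∑ s, k s) → Fin (∑ s, k s) := fun v => if v ∈ U.erase z then σ (p (x v)) else v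
    have hf : f ∈ forests {z} (U.erase z) := by
      simp only [forests, Finset.mem_filter, Finset.mem_univ, true_and]
      refine ⟨fun v hv => if_neg hv, fun v hv => ?_, fun v => d (x v), fun v hv => ?_⟩
      · have hfv : f v = σ (p (x v)) := if_pos hv
        rw [hfv, Finset.mem_singleton, Finset.mem_erase]
        by_cases h : σ (p (x v)) = z
        · exact Or.inl h
        · exact Or.inr ⟨h, hσU _⟩
      · simp only [f, if_pos hv, hσx]
        apply (hp _ _).2
        intro hv'
        rw [Finset.mem_erase] at hv
        exact hv.1 ((hσ1 v r).1 ⟨hv.2, hv'⟩)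
    have b3 := fweight_glue a ha0 {z} (U.erase z) (Finset.univ.erase z) U
      (Finset.erase_subset_erase _ (Finset.subset_univ _)) (by simp)
      (fun v => by
        rw [Finset.mem_singleton, Finset.mem_erase]
        constructor
        · intro h
          by_cases hv : v = z
          · exact Or.inl hv
          · exact Or.inr ⟨hv, h⟩
        · rintro (h | h)
          · rw [h]; exact hσU r
          · exact h.2) f hf
    have e3 : Finset.univ.erase z \ U.erase z = Finset.univ \ U := by
      ext v
      simp only [Finset.mem_sdiff, Finset.mem_erase, Finset.mem_univ]
      have : z ∈ U := hσU r
      by_cases hv : v = z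
      · simp [hv, this]
      · simp [hv]
    rw [e3] at b3
    have e4 : ∏ v ∈ U.erase z, a v (f v) = ∏ s ∈ Finset.univ.erase r, κ s (p s) := by
      symm
      apply Finset.prod_bij (fun s _ => σ s)
      · intro s hs'
        rw [Finset.mem_erase]
        refine ⟨fun h => (Finset.ne_of_mem_erase hs') ?_, hσU s⟩
        rw [← hσx s, h, hz, hσx]
      · intro s _ t _ h
        rw [← hσx s, h, hσx]
      · intro v hv
        rw [Finset.mem_erase] at hv
        have hvx : v = σ (x v) := (hσ1 v (x v)).1 ⟨hv.2, rfl⟩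
        refine ⟨x v, ?_, hvx.symm⟩
        rw [Finset.mem_erase]
        refine ⟨fun h => hv.1 ?_, Finset.mem_univ _⟩
        rw [hvx, h]
      · intro s hs'
        have : σ s ∈ U.erase z := by
          rw [Finset.mem_erase]
          refine ⟨fun h => (Finset.ne_of_mem_erase hs') ?_, hσU s⟩
          rw [← hσx s, h, hz, hσx]
        simp only [a, f, if_pos this, hσx]
    rw [e4] at b3
    have b4 := fweight_le_treeWeight x κ hs h0 z
    have c1 : 0 ≤ ∏ s ∈ Finset.univ.erase r, κ s (p s) := Finset.prod_nonneg fun _ _ => h0 _ _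
    have c2 : 0 ≤ ∏ s, (∑ t, κ s t) ^ m s := Finset.prod_nonneg fun s _ =>
      pow_nonneg (Finset.sum_nonneg fun t _ => h0 _ _) _
    have c3 : 0 < (∏ s, ((m s).factorial : ℝ)) ^ h :=
      pow_pos (Finset.prod_pos fun s _ => by exact_mod_cast Nat.factorial_pos _) _
    calc _ ≤ ((∏ s ∈ Finset.univ.erase r, κ s (p s)) * ∏ s, (∑ t, κ s t) ^ m s) *
          (fweight a M ((Finset.univ \ U) \ M) * (∏ s, ((m s).factorial : ℝ)) ^ h) :=
          mul_le_mul_of_nonneg_left b1 (mul_nonneg c1 c2)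
      _ = (∏ s ∈ Finset.univ.erase r, κ s (p s)) * ((∏ s, (∑ t, κ s t) ^ m s) *
          fweight a M ((Finset.univ \ U) \ M)) * (∏ s, ((m s).factorial : ℝ)) ^ h := by ring
      _ ≤ (∏ s ∈ Finset.univ.erase r, κ s (p s)) * fweight a U (Finset.univ \ U) *
          (∏ s, ((m s).factorial : ℝ)) ^ h := by gcongr
      _ ≤ tau κ k * (∏ s, ((m s).factorial : ℝ)) ^ h := by
          apply mul_le_mul_of_nonneg_right (b3.trans b4) c3.le

lemma ereal_coe_sum_aux {ι : Type*} (s : Finset ι) (f : ι → ℝ) :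
    ((∑ i ∈ s, f i : ℝ) : EReal) = ∑ i ∈ s, (f i : EReal) := by
  induction s using Finset.induction_on with
  | empty => simp
  | insert a s ha ih => rw [Finset.sum_insert ha, Finset.sum_insert ha, EReal.coe_add, ih]

lemma ereal_sum_ne_bot_aux {ι : Type*} (s : Finset ι) (f : ι → EReal) (h : ∀ i ∈ s, f i ≠ ⊥) :
    ∑ i ∈ s, f i ≠ ⊥ := by
  induction s using Finset.induction_on with
  | empty => simp
  | insert a s ha ih =>
    rw [Finset.sum_insert ha]
    exact EReal.add_ne_bot_iff.2 ⟨h a (by simp), ih fun i hi => h i (by simp [hi])⟩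

lemma entTerm_ne_bot (x d : ℝ) : entTerm x d ≠ ⊥ := by
  unfold entTerm
  split_ifs
  · simp
  · simp
  · exact EReal.coe_ne_bot _

lemma entTerm_coe (x d : ℝ) (h : x ≠ 0 → 0 < d) :
    entTerm x d = ((x * Real.log (x / d) : ℝ) : EReal) := by
  unfold entTerm
  split_ifs with h1 h2
  · simp [h1]
  · exact absurd (h h1) (not_lt.2 h2)
  · rfl

lemma exists_min_aux {S : Type*} [Fintype S] (κ : S → S → ℝ) :
    ∃ c : ℝ, 0 < c ∧ ∀ r s, 0 < κ r s → c ≤ κ r s := by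
  let A : Finset ℝ := insert 1 ((Finset.univ.image fun p : S × S => κ p.1 p.2).filter (0 < ·))
  have hA : A.Nonempty := ⟨1, by simp [A]⟩
  refine ⟨A.min' hA, ?_, ?_⟩
  · have := A.min'_mem hA
    simp only [A, Finset.mem_insert, Finset.mem_filter] at this
    rcases this with h | h
    · rw [h]; exact one_pos
    · exact h.2
  · intro r s h
    apply Finset.min'_le
    simp only [A, Finset.mem_insert, Finset.mem_filter, Finset.mem_image, Finset.mem_univ, true_and]
    exact Or.inr ⟨⟨(r, s), rfl⟩, h⟩

lemma pow_fact_bound (k : ℕ) (d : ℝ) (hd : 0 < k → 0 < d) :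
    d ^ k / (k.factorial : ℝ) ≤ Real.exp (k - k * Real.log (k / d)) := by
  rcases Nat.eq_zero_or_pos k with h | h
  · simp [h]
  · have hd' := hd h
    have hk : (0 : ℝ) < k := by exact_mod_cast h
    have h1 := Real.pow_div_factorial_le_exp (k : ℝ) hk.le k
    rw [Real.exp_sub, ← Real.log_pow, Real.exp_log (by positivity), div_pow]
    have h2 : d ^ k / (k.factorial : ℝ) = ((k : ℝ) ^ k / k.factorial) / ((k : ℝ) ^ k / d ^ k) := by
      field_simp
    rw [h2]
    gcongr

lemma chi_prod_bound {S : Type*} [Fintype S] (κ : S → S → ℝ) (h0 : ∀ r s, 0 ≤ κ r s)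
    (θ : S → ℝ) (hθ : ∀ s, 0 ≤ θ s) (c : ℝ) (hc : (c : EReal) < chiFn κ θ) (k : S → ℕ)
    (hk : 0 < ∑ s, k s) :
    ∏ s, (((∑ t, κ s t * k t) * θ s) ^ k s / ((k s).factorial : ℝ)) ≤
      Real.exp (-(c - 1) * (∑ s, k s : ℕ)) := by
  set n : ℕ := ∑ s, k s with hn
  have hn0 : (0 : ℝ) < n := by exact_mod_cast hk
  set d : S → ℝ := fun s => (∑ t, κ s t * k t) * θ s with hd
  have hd0 : ∀ s, 0 ≤ d s := fun s => mul_nonneg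
    (Finset.sum_nonneg fun t _ => mul_nonneg (h0 _ _) (Nat.cast_nonneg _)) (hθ s)
  by_cases hpos : ∀ s, 0 < k s → 0 < d s
  · have h1 : (c : EReal) < ((∑ s, (k s / n : ℝ) * Real.log ((k s / n : ℝ) / (d s / n)) : ℝ) : EReal) := by
      refine hc.trans_le (sInf_le ⟨fun s => k s / n, ?_, ?_, ?_, ?_⟩)
      · intro r; positivity
      · rw [← Finset.sum_div, ← Nat.cast_sum, ← hn, div_self hn0.ne']
      · intro r hr
        rcases Nat.eq_zero_or_pos (k r) with h | h
        · simp [h]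
        · have := hpos r h
          simp [hd, hr] at this
      · rw [ereal_coe_sum_aux]
        refine Finset.sum_congr rfl fun s _ => ?_
        have e : (∑ t, κ s t * ((k t : ℝ) / n)) * θ s = d s / n := by
          have e1 : ∑ t, κ s t * ((k t : ℝ) / n) = (∑ t, κ s t * k t) / n := by
            rw [Finset.sum_div]
            exact Finset.sum_congr rfl fun t _ => by ring
          rw [e1]
          simp only [hd]
          ring
        rw [e, entTerm_coe]
        intro h
        apply div_pos _ hn0
        apply hpos
        rcases Nat.eq_zero_or_pos (k s) with h' | h'
        · simp [h'] at h
        · exact h'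
    have h2 : c * n < ∑ s, (k s : ℝ) * Real.log (k s / d s) := by
      have h3 := EReal.coe_lt_coe_iff.1 h1
      have h4 : ∑ s, (k s / n : ℝ) * Real.log ((k s / n : ℝ) / (d s / n)) =
          (∑ s, (k s : ℝ) * Real.log (k s / d s)) / n := by
        rw [Finset.sum_div]
        refine Finset.sum_congr rfl fun s _ => ?_
        rw [div_div_div_cancel_right₀ hn0.ne']
        ring
      rw [h4, lt_div_iff₀ hn0] at h3
      exact h3
    calc ∏ s, (d s ^ k s / ((k s).factorial : ℝ))
        ≤ ∏ s, Real.exp (k s - k s * Real.log (k s / d s)) := by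
          apply Finset.prod_le_prod
          · intro s _
            have := hd0 s
            positivity
          · intro s _
            exact pow_fact_bound _ _ (hpos s)
      _ = Real.exp (n - ∑ s, (k s : ℝ) * Real.log (k s / d s)) := by
          rw [← Real.exp_sum, Finset.sum_sub_distrib, hn, Nat.cast_sum]
      _ ≤ _ := by
          apply Real.exp_le_exp.2
          linarith
  · push Not at hpos
    obtain ⟨s, hs, hs'⟩ := hpos
    have : d s = 0 := le_antisymm hs' (hd0 s)
    rw [Finset.prod_eq_zero (Finset.mem_univ s)]
    · exact (Real.exp_pos _).le
    · change d s ^ k s / _ = 0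
      rw [this, zero_pow hs.ne', zero_div]

lemma summable_geom_aux {S : Type*} [Fintype S] (ρ : ℝ) (h0 : 0 ≤ ρ) (h1 : ρ < 1) :
    Summable (fun k : S → ℕ => ρ ^ (∑ s, k s)) := by
  apply summable_of_sum_le (c := ∏ _s : S, (1 - ρ)⁻¹)
  · intro k; exact pow_nonneg h0 _
  · intro u
    set N : ℕ := u.sup (fun k => ∑ s, k s) with hN
    have hsub : u ⊆ Fintype.piFinset (fun _ : S => Finset.range (N + 1)) := by
      intro k hk
      rw [Fintype.mem_piFinset]
      intro s
      rw [Finset.mem_range]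
      have h2 : ∑ s, k s ≤ N := Finset.le_sup (f := fun k : S → ℕ => ∑ s, k s) hk
      have h3 := Finset.single_le_sum (f := k) (fun _ _ => Nat.zero_le _) (Finset.mem_univ s)
      omega
    calc ∑ k ∈ u, ρ ^ (∑ s, k s)
        ≤ ∑ k ∈ Fintype.piFinset (fun _ : S => Finset.range (N + 1)), ρ ^ (∑ s, k s) :=
          Finset.sum_le_sum_of_subset_of_nonneg hsub fun _ _ _ => pow_nonneg h0 _
      _ = ∏ _s : S, ∑ i ∈ Finset.range (N + 1), ρ ^ i := by
          rw [Finset.prod_univ_sum]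
          exact Finset.sum_congr rfl fun k _ => by rw [Finset.prod_pow_eq_pow_sum]
      _ ≤ _ := by
          apply Finset.prod_le_prod
          · intro s _
            exact Finset.sum_nonneg fun _ _ => pow_nonneg h0 _
          · intro s _
            rw [← tsum_geometric_of_lt_one h0 h1]
            exact (summable_geometric_of_lt_one h0 h1).sum_le_tsum _ fun _ _ => pow_nonneg h0 _

lemma treeWeight_nonneg {S : Type*} (n : ℕ) (x : Fin n → S) (κ : S → S → ℝ)
    (h0 : ∀ r s, 0 ≤ κ r s) : 0 ≤ treeWeight n x κ :=
  Finset.sum_nonneg fun _ _ => Finset.prod_nonneg fun _ _ => h0 _ _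

lemma part_one {S : Type*} [Fintype S] (κ : S → S → ℝ)
    (hs : ∀ r s, κ r s = κ s r) (h0 : ∀ r s, 0 ≤ κ r s)
    (θ : S → ℝ) (hθ : ∀ s, 0 ≤ θ s) (hχ : (1 : EReal) < chiFn κ θ) (r : S) :
    Gamma0 κ θ r ≠ ⊤ := by
  obtain ⟨c, hc1, hc⟩ := EReal.lt_iff_exists_real_btwn.1 hχ
  have hc1' : 1 < c := by exact_mod_cast hc1
  obtain ⟨b, hb0, hb⟩ := exists_min_aux κ
  set ε := (c - 1) / 2 with hε
  have hε0 : 0 < ε := by rw [hε]; linarith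
  have hsum : Summable (fun k : S → ℕ =>
      tau κ k * (k r : ℝ) * ∏ s : S, θ s ^ (k s) / (Nat.factorial (k s) : ℝ)) := by
    have hg := (summable_geom_aux (S := S) (Real.exp (-ε)) (Real.exp_pos _).le
      (by rw [Real.exp_lt_one_iff]; linarith)).mul_left (b⁻¹ * ε⁻¹)
    apply Summable.of_norm_bounded_eventually hg
    have hfin : Set.Finite {k : S → ℕ | ∑ s, k s < 2} := by
      apply (Set.Finite.pi' (fun _ : S => Set.finite_lt_nat 2)).subset
      intro k hk s
      have h3 := Finset.single_le_sum (f := k) (fun _ _ => Nat.zero_le _) (Finset.mem_univ s)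
      exact lt_of_le_of_lt h3 hk
    filter_upwards [hfin.compl_mem_cofinite] with k hk
    have hk2 : 2 ≤ ∑ s, k s := by
      have hk3 : ¬ (∑ s, k s < 2) := hk
      omega
    have hτ0 : 0 ≤ tau κ k := treeWeight_nonneg _ _ _ h0
    have hprod0 : 0 ≤ ∏ s : S, θ s ^ (k s) / (Nat.factorial (k s) : ℝ) :=
      Finset.prod_nonneg fun s _ => div_nonneg (pow_nonneg (hθ s) _) (Nat.cast_nonneg _)
    rw [Real.norm_of_nonneg (mul_nonneg (mul_nonneg hτ0 (Nat.cast_nonneg _)) hprod0)]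
    have h1 : b * tau κ k ≤ ∏ s, (∑ t, κ s t * k t) ^ k s := by
      have h2 := treeWeight_upper hk2 (compatVec k) κ hs h0 b hb
      have e : ∏ v, ∑ u, κ (compatVec k v) (compatVec k u) = ∏ s, (∑ t, κ s t * k t) ^ k s := by
        have : ∀ v, ∑ u, κ (compatVec k v) (compatVec k u) = ∑ t, κ (compatVec k v) t * k t := by
          intro v
          rw [pop_sum (compatVec k) Finset.univ (fun t => κ (compatVec k v) t)]
          exact Finset.sum_congr rfl fun t _ => by rw [pop_compatVec]
        simp_rw [this]
        rw [pop_prod (compatVec k) Finset.univ (fun s => ∑ t, κ s t * k t)]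
        exact Finset.prod_congr rfl fun t _ => by rw [pop_compatVec]
      rw [e] at h2
      exact h2
    have h3 := chi_prod_bound κ h0 θ hθ c hc k (by omega)
    have h4 : b * tau κ k * ∏ s : S, θ s ^ (k s) / (Nat.factorial (k s) : ℝ) ≤
        Real.exp (-(c - 1) * (∑ s, k s : ℕ)) := by
      refine (mul_le_mul_of_nonneg_right h1 hprod0).trans (le_trans (le_of_eq ?_) h3)
      rw [← Finset.prod_mul_distrib]
      exact Finset.prod_congr rfl fun s _ => by rw [mul_pow]; ring
    set n : ℕ := ∑ s, k s with hn
    have h5 : (k r : ℝ) ≤ n := by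
      have h3 := Finset.single_le_sum (f := k) (fun _ _ => Nat.zero_le _) (Finset.mem_univ r)
      exact_mod_cast h3
    have h6 : (k r : ℝ) ≤ ε⁻¹ * Real.exp (ε * n) := by
      have := Real.add_one_le_exp (ε * n)
      rw [← div_eq_inv_mul, le_div_iff₀ hε0]
      nlinarith
    calc tau κ k * (k r : ℝ) * ∏ s : S, θ s ^ (k s) / (Nat.factorial (k s) : ℝ)
        = b⁻¹ * (b * tau κ k * ∏ s : S, θ s ^ (k s) / (Nat.factorial (k s) : ℝ)) * (k r : ℝ) := by
          field_simp
      _ ≤ b⁻¹ * Real.exp (-(c - 1) * n) * (ε⁻¹ * Real.exp (ε * n)) := by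
          gcongr
      _ = b⁻¹ * ε⁻¹ * (Real.exp (-(c - 1) * n) * Real.exp (ε * n)) := by ring
      _ = b⁻¹ * ε⁻¹ * Real.exp (-ε) ^ n := by
          rw [← Real.exp_add, ← Real.exp_nat_mul]
          congr 2
          rw [hε]; ring
  exact hsum.tsum_ofReal_ne_top

lemma log_fact_bound (n : ℕ) (hn : 0 < n) :
    Real.log (n.factorial) ≤ 1 + Real.log n + n * Real.log n - n := by
  induction n, hn using Nat.le_induction with
  | base => simp
  | succ n hn ih =>
    have hn0 : (0 : ℝ) < n := by exact_mod_cast hn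
    rw [Nat.factorial_succ, Nat.cast_mul, Real.log_mul (by positivity) (by positivity)]
    push_cast
    have h1 := Real.log_le_sub_one_of_pos (show (0 : ℝ) < n / (n + 1) by positivity)
    rw [Real.log_div (by positivity) (by positivity)] at h1
    have h2 : (n : ℝ) / (n + 1) - 1 = -1 / (n + 1) := by field_simp; ring
    rw [h2] at h1
    have h3 : ((n : ℝ) + 1) * (Real.log n - Real.log (n + 1)) ≤ -1 := by
      have := mul_le_mul_of_nonneg_left h1 (show (0 : ℝ) ≤ n + 1 by positivity)
      rwa [mul_div_cancel₀ _ (by positivity)] at this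
    nlinarith

lemma exists_m {S : Type*} [Fintype S] (κ : S → S → ℝ) (h0 : ∀ r s, 0 ≤ κ r s)
    (θ : S → ℝ) (hθ : ∀ s, 0 < θ s) (hχ : chiFn κ θ < (1 : EReal)) :
    ∃ m : S → ℕ, (∀ s, 0 < m s → 0 < ∑ t, κ s t) ∧
      1 < ∏ s, (((∑ t, κ s t * m t) * θ s) ^ m s / ((m s).factorial : ℝ)) := by
  obtain ⟨v, ⟨w, hw0, hw1, -, rfl⟩, hv⟩ := sInf_lt_iff.1 hχ
  set d : S → ℝ := fun s => (∑ t, κ s t * w t) * θ s with hd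
  have hpos : ∀ s, w s ≠ 0 → 0 < d s := by
    intro s hs
    by_contra hc
    have : entTerm (w s) (d s) = ⊤ := by
      unfold entTerm
      rw [if_neg hs, if_pos (not_lt.1 hc)]
    rw [← Finset.add_sum_erase _ _ (Finset.mem_univ s), this, EReal.top_add_of_ne_bot] at hv
    · exact absurd hv (not_lt.2 le_top)
    · exact ereal_sum_ne_bot_aux _ _ fun _ _ => entTerm_ne_bot _ _
  have hreal : ∑ s, w s * Real.log (w s / d s) < 1 := by
    have : ∑ s, entTerm (w s) (d s) = ((∑ s, w s * Real.log (w s / d s) : ℝ) : EReal) := by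
      rw [ereal_coe_sum_aux]
      exact Finset.sum_congr rfl fun s _ => entTerm_coe _ _ (hpos s)
    rw [this] at hv
    exact_mod_cast hv
  -- approximations
  let m : ℝ → S → ℕ := fun X s => ⌊w s * X⌋₊
  let a : ℝ → S → ℝ := fun X s => (m X s : ℝ) / X
  have ha : ∀ s, Tendsto (fun X => a X s) atTop (nhds (w s)) := fun s =>
    tendsto_nat_floor_mul_div_atTop (hw0 s)
  have hκa : ∀ s, Tendsto (fun X => (∑ t, κ s t * a X t) * θ s) atTop (nhds (d s)) := fun s =>
    (tendsto_finset_sum _ fun t _ => (ha t).const_mul _).mul_const _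
  let B : ℝ → S → ℝ := fun X s => if w s = 0 then 0 else
    a X s * Real.log ((∑ t, κ s t * a X t) * θ s / a X s) + a X s
      - (Real.log (m X s) / (m X s) * a X s + 1 / X)
  have hwpos : ∀ s, w s ≠ 0 → 0 < w s := fun s h => lt_of_le_of_ne (hw0 s) (Ne.symm h)
  have hmtop : ∀ s, w s ≠ 0 → Tendsto (fun X => (m X s : ℝ)) atTop atTop := by
    intro s hs
    apply tendsto_natCast_atTop_atTop.comp
    exact tendsto_nat_floor_atTop.comp (tendsto_id.const_mul_atTop (hwpos s hs))
  have hB : ∀ s, Tendsto (fun X => B X s) atTop (nhds (w s - w s * Real.log (w s / d s))) := by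
    intro s
    by_cases hs : w s = 0
    · simp [B, hs]
    · simp only [B, if_neg hs]
      have l1 : Tendsto (fun X => Real.log ((∑ t, κ s t * a X t) * θ s / a X s)) atTop
          (nhds (Real.log (d s / w s))) :=
        ((hκa s).div (ha s) hs).log (div_pos (hpos s hs) (hwpos s hs)).ne'
      have l2 : Tendsto (fun X => Real.log (m X s) / (m X s)) atTop (nhds 0) :=
        Real.isLittleO_log_id_atTop.tendsto_div_nhds_zero.comp (hmtop s hs)
      have l3 : Tendsto (fun X : ℝ => 1 / X) atTop (nhds 0) := by
        simpa using tendsto_inv_atTop_zero (𝕜 := ℝ)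
      have := (((ha s).mul l1).add (ha s)).sub ((l2.mul (ha s)).add l3)
      convert this using 2
      rw [← inv_div, Real.log_inv]
      ring
  have hBsum : Tendsto (fun X => ∑ s, B X s) atTop
      (nhds (∑ s, (w s - w s * Real.log (w s / d s)))) := tendsto_finset_sum _ fun s _ => hB s
  have hlim : 0 < ∑ s, (w s - w s * Real.log (w s / d s)) := by
    rw [Finset.sum_sub_distrib, hw1]; linarith
  have ev1 := hBsum.eventually (lt_mem_nhds hlim)
  have ev2 : ∀ᶠ X in atTop, ∀ s, w s ≠ 0 → 0 < (∑ t, κ s t * a X t) * θ s := by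
    rw [Filter.eventually_all]
    intro s
    by_cases hs : w s = 0
    · simp [hs]
    · filter_upwards [(hκa s).eventually (lt_mem_nhds (hpos s hs))] with X hX _
      exact hX
  have ev3 : ∀ᶠ X in atTop, ∀ s, w s ≠ 0 → 0 < (m X s : ℝ) := by
    rw [Filter.eventually_all]
    intro s
    by_cases hs : w s = 0
    · simp [hs]
    · filter_upwards [(hmtop s hs).eventually (eventually_gt_atTop 0)] with X hX _
      exact hX
  obtain ⟨X, h1, h2, h3, hX⟩ := (ev1.and (ev2.and (ev3.and (eventually_gt_atTop (0 : ℝ))))).exists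
  have hm0 : ∀ s, w s = 0 → m X s = 0 := fun s hs => by simp [m, hs]
  have hdm : ∀ s, (∑ t, κ s t * (m X t : ℝ)) * θ s = X * ((∑ t, κ s t * a X t) * θ s) := by
    intro s
    rw [← mul_assoc, Finset.mul_sum]
    congr 1
    refine Finset.sum_congr rfl fun t _ => ?_
    simp only [a]
    field_simp
  refine ⟨m X, ?_, ?_⟩
  · intro s hs
    have hws : w s ≠ 0 := fun h => by rw [hm0 s h] at hs; exact lt_irrefl _ hs
    by_contra hc
    have hz : ∑ t, κ s t = 0 := le_antisymm (not_lt.1 hc) (Finset.sum_nonneg fun t _ => h0 s t)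
    have hz' : ∀ t, κ s t = 0 := fun t =>
      (Finset.sum_eq_zero_iff_of_nonneg (fun t _ => h0 s t)).1 hz t (Finset.mem_univ t)
    have := h2 s hws
    simp [hz'] at this
  · have hfac : ∀ s, 0 < ((∑ t, κ s t * (m X t : ℝ)) * θ s) ^ m X s / ((m X s).factorial : ℝ) := by
      intro s
      apply div_pos _ (by positivity)
      by_cases hs : w s = 0
      · rw [hm0 s hs]; simp
      · apply pow_pos
        rw [hdm]
        exact mul_pos hX (h2 s hs)
    rw [← Real.log_pos_iff (Finset.prod_nonneg fun s _ => (hfac s).le),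
      Real.log_prod (fun s _ => (hfac s).ne')]
    refine lt_of_lt_of_le (mul_pos hX h1) ?_
    rw [Finset.mul_sum]
    apply Finset.sum_le_sum
    intro s _
    by_cases hs : w s = 0
    · simp [B, hs, hm0 s hs]
    · have hms := h3 s hs
      have hms' : 0 < m X s := by exact_mod_cast hms
      have hdp := h2 s hs
      simp only [B, if_neg hs]
      rw [hdm, Real.log_div (pow_pos (mul_pos hX hdp) _).ne' (by positivity), Real.log_pow,
        Real.log_mul hX.ne' hdp.ne']
      have hf := log_fact_bound (m X s) hms'
      have has : a X s = m X s / X := rfl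
      have hasp : 0 < a X s := div_pos hms hX
      rw [Real.log_div hdp.ne' hasp.ne']
      generalize Real.log ((∑ t, κ s t * a X t) * θ s) = Q at *
      have hla : Real.log (a X s) = Real.log (m X s) - Real.log X := by
        rw [has, Real.log_div hms.ne' hX.ne']
      rw [hla, has]
      have e : X * ((m X s : ℝ) / X * (Q - (Real.log (m X s) - Real.log X)) + m X s / X -
          (Real.log (m X s) / m X s * (m X s / X) + 1 / X)) =
          m X s * (Q - (Real.log (m X s) - Real.log X)) + m X s - (Real.log (m X s) + 1) := by
        field_simp
      rw [e]
      linarith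

lemma fact_ratio_bound (a u : ℕ) : (a + u).factorial ≤ a.factorial * (a + u) ^ u := by
  rw [← Nat.factorial_mul_ascFactorial]
  exact Nat.mul_le_mul_left _ (Nat.ascFactorial_le_pow_add _ _)

lemma part_two {S : Type*} [Fintype S] [Nonempty S] (κ : S → S → ℝ)
    (hs : ∀ r s, κ r s = κ s r) (h0 : ∀ r s, 0 ≤ κ r s)
    (θ : S → ℝ) (hθ : ∀ s, 0 < θ s) (hirr : Irred κ θ) (hχ : chiFn κ θ < (1 : EReal)) (r : S) :
    Gamma0 κ θ r = ⊤ := by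
  obtain ⟨m, hm, hq⟩ := exists_m κ h0 θ hθ hχ
  obtain ⟨C, hC, hτ⟩ := tau_lower κ hs h0 θ hθ hirr m hm
  set q := ∏ s, (((∑ t, κ s t * m t) * θ s) ^ m s / ((m s).factorial : ℝ)) with hqdef
  by_contra hne
  have hne' : Gamma0 κ θ r ≠ ⊤ := hne
  unfold Gamma0 at hne'
  have htend := ENNReal.tendsto_cofinite_zero_of_tsum_ne_top hne'
  have hm0 : ∃ s, m s ≠ 0 := by
    by_contra hc
    push Not at hc
    rw [hqdef] at hq
    simp [hc] at hq
  obtain ⟨s₀, hs₀⟩ := hm0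
  let K : ℕ → S → ℕ := fun h s => 1 + m s + h * m s
  have hK : Function.Injective K := by
    intro h h' e
    have := congrFun e s₀
    simp only [K, Nat.add_left_cancel_iff] at this
    exact Nat.eq_of_mul_eq_mul_right (Nat.pos_of_ne_zero hs₀) this
  have ht2 := htend.comp hK.tendsto_cofinite
  rw [Nat.cofinite_eq_atTop] at ht2
  set u : S → ℕ := fun s => 1 + m s with hu
  set D : ℕ := ∑ s, u s with hD
  set C' : ℝ := C * (∏ s, θ s ^ u s) / (D : ℝ) ^ D with hC'
  have hD0 : 0 < D := Finset.sum_pos (fun s _ => by simp [hu]) Finset.univ_nonempty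
  have hC'0 : 0 < C' := by
    have : 0 < ∏ s, θ s ^ u s := Finset.prod_pos fun s _ => pow_pos (hθ s) _
    have : (0 : ℝ) < D := by exact_mod_cast hD0
    positivity
  -- lower bound of the terms
  have hlow : ∀ h : ℕ, C' * (q ^ h / ((h + 1 : ℕ) : ℝ) ^ D) ≤
      tau κ (K h) * (K h r : ℝ) * ∏ s : S, θ s ^ (K h s) / (Nat.factorial (K h s) : ℝ) := by
    intro h
    have t1 := hτ h
    set F : ℝ := ∏ s, ((m s).factorial : ℝ) with hF
    set P : ℝ := ∏ s, (∑ t, κ s t * m t) ^ m s with hP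
    set H : ℝ := ∏ s, ((h * m s).factorial : ℝ) with hH
    have hF0 : 0 < F := Finset.prod_pos fun s _ => by exact_mod_cast Nat.factorial_pos _
    have hH0 : 0 < H := Finset.prod_pos fun s _ => by exact_mod_cast Nat.factorial_pos _
    have hP0 : 0 ≤ P := Finset.prod_nonneg fun s _ =>
      pow_nonneg (Finset.sum_nonneg fun t _ => mul_nonneg (h0 _ _) (Nat.cast_nonneg _)) _
    set Θ : ℝ := ∏ s, θ s ^ m s with hΘ
    have hΘ0 : 0 < Θ := Finset.prod_pos fun s _ => pow_pos (hθ s) _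
    set T : ℝ := ∏ s, θ s ^ u s with hT
    have hT0 : 0 < T := Finset.prod_pos fun s _ => pow_pos (hθ s) _
    set W : ℝ := ∏ s, ((K h s).factorial : ℝ) with hW
    have hW0 : 0 < W := Finset.prod_pos fun s _ => by exact_mod_cast Nat.factorial_pos _
    have eq : q = P * Θ / F := by
      rw [hqdef, hP, hΘ, hF, ← Finset.prod_mul_distrib, ← Finset.prod_div_distrib]
      exact Finset.prod_congr rfl fun s _ => by rw [mul_pow]
    have eprod : ∏ s : S, θ s ^ (K h s) / (Nat.factorial (K h s) : ℝ) = T * Θ ^ h / W := by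
      rw [hT, hΘ, hW, ← Finset.prod_pow, ← Finset.prod_mul_distrib, ← Finset.prod_div_distrib]
      refine Finset.prod_congr rfl fun s _ => ?_
      rw [← pow_mul, ← pow_add, mul_comm (m s) h]
    have hWb : W ≤ H * ((D : ℝ) * ((h + 1 : ℕ) : ℝ)) ^ D := by
      rw [hD, ← Finset.prod_pow_eq_pow_sum, hW, hH, ← Finset.prod_mul_distrib]
      apply Finset.prod_le_prod
      · intro s _; positivity
      · intro s _
        have b1 := fact_ratio_bound (h * m s) (u s)
        have b2 : h * m s + u s = K h s := by simp only [K, hu]; ring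
        rw [b2] at b1
        have b3 : u s ≤ ∑ s, u s :=
          Finset.single_le_sum (f := u) (fun _ _ => Nat.zero_le _) (Finset.mem_univ s)
        have b4 : K h s ≤ (∑ s, u s) * (h + 1) := by
          calc K h s ≤ u s * (h + 1) := by simp only [K, hu]; nlinarith
            _ ≤ _ := Nat.mul_le_mul_right _ b3
        have b5 : (K h s).factorial ≤ (h * m s).factorial * ((∑ s, u s) * (h + 1)) ^ u s :=
          b1.trans (Nat.mul_le_mul_left _ (Nat.pow_le_pow_left b4 _))
        exact_mod_cast b5
    have t2 : C * (H * P ^ h) / F ^ h ≤ tau κ (K h) := by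
      rw [div_le_iff₀ (pow_pos hF0 h)]
      exact t1
    have hτ0 : 0 ≤ tau κ (K h) := treeWeight_nonneg _ _ _ h0
    have hkr : (1 : ℝ) ≤ K h r := by
      have : 1 ≤ K h r := by simp only [K]; omega
      exact_mod_cast this
    have hDpos : (0 : ℝ) < D := by exact_mod_cast hD0
    have hhpos : (0 : ℝ) < ((h + 1 : ℕ) : ℝ) := by positivity
    rw [eprod]
    calc C' * (q ^ h / ((h + 1 : ℕ) : ℝ) ^ D)
        = C * (H * P ^ h) / F ^ h * 1 * (T * Θ ^ h / (H * ((D : ℝ) * ((h + 1 : ℕ) : ℝ)) ^ D)) := by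
          rw [hC', eq, div_pow, mul_pow, mul_pow]
          field_simp
      _ ≤ tau κ (K h) * (K h r : ℝ) * (T * Θ ^ h / W) := by
          gcongr
  have hbig : Tendsto (fun h : ℕ => ((h + 1 : ℕ) : ℝ) ^ D / q ^ h) atTop (nhds 0) := by
    have := ((tendsto_pow_const_div_const_pow_of_one_lt D hq).comp (tendsto_add_atTop_nat 1)).mul_const q
    rw [zero_mul] at this
    refine this.congr fun h => ?_
    have hq0 : 0 < q := lt_trans one_pos hq
    simp only [Function.comp_apply]
    rw [pow_succ]
    field_simp
  have ev1 := hbig.eventually (gt_mem_nhds hC'0)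
  have ev2 := ht2.eventually (gt_mem_nhds (show (0 : ℝ≥0∞) < 1 from one_pos))
  obtain ⟨h, e1, e2⟩ := (ev1.and ev2).exists
  simp only [Function.comp_apply] at e2
  rw [ENNReal.ofReal_lt_one] at e2
  have hq0 : 0 < q := lt_trans one_pos hq
  have hh : (0 : ℝ) < ((h + 1 : ℕ) : ℝ) ^ D := by positivity
  have h5 := lt_of_le_of_lt (hlow h) e2
  rw [div_lt_iff₀ (pow_pos hq0 h)] at e1
  rw [← mul_div_assoc, div_lt_one hh] at h5
  linarith

/-- convergence/divergence criterion for the series `Γ` in terms of `χ`. -/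
theorem Gamma_convergence_criterion
    {S : Type*} [Fintype S] [DecidableEq S] [Nonempty S]
    (κ : S → S → ℝ) (hκsym : ∀ r s, κ r s = κ s r) (hκ0 : ∀ r s, 0 ≤ κ r s)
    (θ : S → ℝ) (hθ : ∀ s, 0 ≤ θ s) :
    ((1 : EReal) < chiFn κ θ → ∀ r, Gamma0 κ θ r ≠ ⊤) ∧
      ((∀ s, 0 < θ s) → Irred κ θ → chiFn κ θ < (1 : EReal) → ∀ r, Gamma0 κ θ r = ⊤) := by
  exact ⟨fun h r => part_one κ hκsym hκ0 θ hθ h r,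
    fun hp hi h r => part_two κ hκsym hκ0 θ hp hi h r⟩


end
end
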